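/- Entropy Power Inequality with quantum conditioning: Let X and Y be random variables with values in ℝⁿ correlated with a finite-dimensional quantum system M, with E‖X‖² and E‖Y‖² finite, with the map (x,y) ↦ ρ(x,y) (the state of M conditioned on X = x, Y = y) continuous in trace norm, with all conditional entropies involved finite, and with X and Y conditionally independent given M, i.e. I(X:Y|M) = 0. Then exp(2S(X+Y|M)/n) ≥ exp(2S(X|M)/n) + exp(2S(Y|M)/n). -/

import Mathlib

open MeasureTheory Real Filter Topology
open scoped ComplexOrder

noncomputable section

/-- `ℝⁿ`. -/
abbrev En (n : ℕ) := EuclideanSpace ℝ (Fin n)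

/-- The density of the standard Gaussian probability measure on `ℝⁿ`. -/
def gaussDensity (n : ℕ) (z : En n) : ℝ :=
  (2 * π) ^ (-(n : ℝ) / 2) * Real.exp (-‖z‖ ^ 2 / 2)

/-- A state of a finite-dimensional quantum system: a positive semidefinite matrix
with unit trace. -/
def IsState {ι : Type*} [Fintype ι] [DecidableEq ι] (ρ : Matrix ι ι ℂ) : Prop :=
  ρ.PosSemidef ∧ ρ.trace = 1

open scoped Classical in
/-- The von Neumann entropy `S(ρ) = -Σᵢ λᵢ ln λᵢ` of a (Hermitian) matrix, the sum running
over its eigenvalues (with the convention `0 ln 0 = 0`; junk value `0` on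
non-Hermitian matrices). -/
def vnEnt {ι : Type*} [Fintype ι] [DecidableEq ι] (ρ : Matrix ι ι ℂ) : ℝ :=
  if h : ρ.IsHermitian then -∑ i, h.eigenvalues i * Real.log (h.eigenvalues i) else 0

/-- The classical (differential or discrete) entropy `S = -∫ p ln p` of a density `p`. -/
def clEnt {α : Type*} [MeasureSpace α] (p : α → ℝ) : ℝ := -∫ a, p a * Real.log (p a)

/-- The average state `∫ p(a) ρ(a) da` of a classical-quantum state. -/
def avgState {α : Type*} [MeasureSpace α] {d : ℕ} (p : α → ℝ)
    (ρ : α → Matrix (Fin d) (Fin d) ℂ) : Matrix (Fin d) (Fin d) ℂ :=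
  Matrix.of fun i j => ∫ a, (p a : ℂ) * ρ a i j

/-- The conditional entropy `S(A|M) = S(M|A) + S(A) - S(M)` of the classical system `A`
of a classical-quantum state `(p, ρ)` given the quantum system `M`. -/
def condEnt {α : Type*} [MeasureSpace α] {d : ℕ} (p : α → ℝ)
    (ρ : α → Matrix (Fin d) (Fin d) ℂ) : ℝ :=
  (∫ a, p a * vnEnt (ρ a)) + clEnt p - vnEnt (avgState p ρ)

/-- The integrability conditions expressing that the conditional entropy `S(A|M)` of the
classical-quantum state `(p, ρ)` is finite. -/
def EntFinite {α : Type*} [MeasureSpace α] {d : ℕ} (p : α → ℝ)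
    (ρ : α → Matrix (Fin d) (Fin d) ℂ) : Prop :=
  Integrable (fun a => p a * Real.log (p a)) ∧ Integrable (fun a => p a * vnEnt (ρ a))

/-- The marginal density of the first variable of a joint density on `ℝⁿ × ℝⁿ`. -/
def margFst {n : ℕ} (p : En n × En n → ℝ) : En n → ℝ := fun x => ∫ y, p (x, y)

/-- The state of `M` conditioned on the first classical variable:
`ρ_X(x) = (∫ p(x,y) ρ(x,y) dy) / p_X(x)`. -/
def margFstState {n d : ℕ} (p : En n × En n → ℝ)
    (ρ : En n × En n → Matrix (Fin d) (Fin d) ℂ) : En n → Matrix (Fin d) (Fin d) ℂ :=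
  fun x => ((margFst p x : ℂ))⁻¹ • Matrix.of fun i j => ∫ y, (p (x, y) : ℂ) * ρ (x, y) i j

/-- The marginal density of the second variable of a joint density on `ℝⁿ × ℝⁿ`. -/
def margSnd {n : ℕ} (p : En n × En n → ℝ) : En n → ℝ := fun y => ∫ x, p (x, y)

/-- The state of `M` conditioned on the second classical variable. -/
def margSndState {n d : ℕ} (p : En n × En n → ℝ)
    (ρ : En n × En n → Matrix (Fin d) (Fin d) ℂ) : En n → Matrix (Fin d) (Fin d) ℂ :=
  fun y => ((margSnd p y : ℂ))⁻¹ • Matrix.of fun i j => ∫ x, (p (x, y) : ℂ) * ρ (x, y) i j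

/-- The density of the sum `X + Y`: `p_S(s) = ∫ p(x, s - x) dx`. -/
def sumDensity {n : ℕ} (p : En n × En n → ℝ) : En n → ℝ := fun s => ∫ x, p (x, s - x)

/-- The state of `M` conditioned on `X + Y = s`. -/
def sumState {n d : ℕ} (p : En n × En n → ℝ)
    (ρ : En n × En n → Matrix (Fin d) (Fin d) ℂ) : En n → Matrix (Fin d) (Fin d) ℂ :=
  fun s => ((sumDensity p s : ℂ))⁻¹ •
    Matrix.of fun i j => ∫ x, (p (x, s - x) : ℂ) * ρ (x, s - x) i j

/-- The conditional mutual information `I(X:Y|M) = S(X|M) + S(Y|M) - S(X,Y|M)` of the two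
classical variables of a joint classical-quantum state on `ℝⁿ × ℝⁿ` given `M`. -/
def condMI {n d : ℕ} (p : En n × En n → ℝ)
    (ρ : En n × En n → Matrix (Fin d) (Fin d) ℂ) : ℝ :=
  condEnt (margFst p) (margFstState p ρ) + condEnt (margSnd p) (margSndState p ρ)
    - condEnt p ρ

/-- The joint density of `(A + c Z, Z)` where `A` has density `q` and `Z` is an independent
standard Gaussian. -/
def noisyDensity {n : ℕ} (c : ℝ) (q : En n → ℝ) : En n × En n → ℝ :=
  fun wz => gaussDensity n wz.2 * q (wz.1 - c • wz.2)

/-- The state of `M` conditioned on `A + c Z = w` and `Z = z`, namely `σ(w - c z)`. -/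
def noisyState {n d : ℕ} (c : ℝ) (σ : En n → Matrix (Fin d) (Fin d) ℂ) :
    En n × En n → Matrix (Fin d) (Fin d) ℂ :=
  fun wz => σ (wz.1 - c • wz.2)

/-- The mutual information `I(A + c Z : Z | M)` for a classical-quantum state `(q, σ)`. -/
def noisyMI {n d : ℕ} (c : ℝ) (q : En n → ℝ) (σ : En n → Matrix (Fin d) (Fin d) ℂ) : ℝ :=
  condMI (noisyDensity c q) (noisyState c σ)

/-- The heat-semigroup-evolved conditional entropy `t ↦ S(A + √t Z | M)`. -/
def heatEnt {n d : ℕ} (q : En n → ℝ) (σ : En n → Matrix (Fin d) (Fin d) ℂ) (t : ℝ) : ℝ :=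
  condEnt (margFst (noisyDensity (Real.sqrt t) q))
    (margFstState (noisyDensity (Real.sqrt t) q) (noisyState (Real.sqrt t) σ))

/-- The difference quotient `I(A + √t Z : Z | M) / t` whose limit as `t → 0⁺` is the
conditional Fisher information `J(A|M)`. -/
def fisherSlope {n d : ℕ} (q : En n → ℝ) (σ : En n → Matrix (Fin d) (Fin d) ℂ) (t : ℝ) : ℝ :=
  noisyMI (Real.sqrt t) q σ / t

/-- The conditional Fisher information `J(A|M) = lim_{t→0⁺} I(A + √t Z : Z | M) / t`, as an
extended real number (the limit always exists, and is computed here as a `limsup`). -/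
def condFisher {n d : ℕ} (q : En n → ℝ) (σ : En n → Matrix (Fin d) (Fin d) ℂ) : EReal :=
  Filter.limsup (fun t : ℝ => ((fisherSlope q σ t : ℝ) : EReal)) (𝓝[>] (0 : ℝ))

/-- The basic regularity hypotheses on a classical-quantum state `(p, ρ)`:
`p` is a probability density and `ρ` is a (trace-norm continuous) family of states. -/
def IsCQState {α : Type*} [MeasureSpace α] [TopologicalSpace α] {d : ℕ} (p : α → ℝ)
    (ρ : α → Matrix (Fin d) (Fin d) ℂ) : Prop :=
  Measurable p ∧ (∀ a, 0 ≤ p a) ∧ (∫ a, p a) = 1 ∧ Continuous ρ ∧ ∀ a, IsState (ρ a)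

section Aux
set_option linter.unusedSectionVars false
open scoped Matrix.Norms.L2Operator

section partA

/-! ### Matrix preliminaries -/

abbrev Mat (d : ℕ) := Matrix (Fin d) (Fin d) ℂ

/-- Real part of the trace. -/
def rtr {d : ℕ} (A : Mat d) : ℝ := A.trace.re

/-- Real part of the trace of `A * K` as a continuous linear map in `A`. -/
def rtrMulL {d : ℕ} (K : Mat d) : Mat d →L[ℝ] ℝ :=
  LinearMap.toContinuousLinearMap
    { toFun := fun A => rtr (A * K)
      map_add' := by intro A B; simp [rtr, add_mul]
      map_smul' := by intro c A; simp [rtr] }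

@[simp] lemma rtrMulL_apply {d : ℕ} (K A : Mat d) : rtrMulL K A = rtr (A * K) := rfl

/-- Real part of the trace as a continuous linear map. -/
def rtrL {d : ℕ} : Mat d →L[ℝ] ℝ := rtrMulL 1

@[simp] lemma rtrL_apply {d : ℕ} (A : Mat d) : rtrL A = rtr A := by simp [rtrL]

/-- squared overlaps between eigenbases -/
def ov {d : ℕ} {A B : Mat d} (hA : A.IsHermitian) (hB : B.IsHermitian) (j i : Fin d) : ℂ :=
  (star (hB.eigenvectorUnitary : Mat d) * (hA.eigenvectorUnitary : Mat d)) j i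

lemma spec_eq {d : ℕ} {A : Mat d} (hA : A.IsHermitian) :
    A = (hA.eigenvectorUnitary : Mat d) * Matrix.diagonal (fun i => (hA.eigenvalues i : ℂ))
      * star (hA.eigenvectorUnitary : Mat d) := by
  conv_lhs => rw [hA.spectral_theorem]
  rfl

lemma cfc_spec_eq {d : ℕ} {A : Mat d} (hA : A.IsHermitian) (f : ℝ → ℝ) :
    cfc f A = (hA.eigenvectorUnitary : Mat d) *
      Matrix.diagonal (fun i => (f (hA.eigenvalues i) : ℂ))
      * star (hA.eigenvectorUnitary : Mat d) := by
  rw [hA.cfc_eq]; rfl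

lemma unit_star_mul {d : ℕ} {A : Mat d} (hA : A.IsHermitian) :
    star (hA.eigenvectorUnitary : Mat d) * (hA.eigenvectorUnitary : Mat d) = 1 := by simp

lemma unit_mul_star {d : ℕ} {A : Mat d} (hA : A.IsHermitian) :
    (hA.eigenvectorUnitary : Mat d) * star (hA.eigenvectorUnitary : Mat d) = 1 := by simp

lemma ov_sum_left {d : ℕ} {A B : Mat d} (hA : A.IsHermitian) (hB : B.IsHermitian) (i : Fin d) :
    ∑ j, ‖ov hA hB j i‖ ^ 2 = 1 := by
  set U : Mat d := (hA.eigenvectorUnitary : Mat d)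
  set V : Mat d := (hB.eigenvectorUnitary : Mat d)
  have h : star (star V * U) * (star V * U) = 1 := by
    rw [star_mul, star_star]
    calc star U * V * (star V * U) = star U * (V * star V) * U := by simp only [mul_assoc]
      _ = 1 := by rw [unit_mul_star hB, mul_one, unit_star_mul hA]
  have h2 := congrFun (congrFun h i) i
  rw [Matrix.mul_apply, Matrix.one_apply_eq] at h2
  have h3 : ((∑ j, ‖ov hA hB j i‖ ^ 2 : ℝ) : ℂ) = 1 := by
    rw [← h2]; push_cast
    refine Finset.sum_congr rfl fun j _ => ?_
    rw [Matrix.star_apply]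
    change _ = star (ov hA hB j i) * ov hA hB j i
    rw [← Complex.conj_mul']; rfl
  exact_mod_cast h3

lemma ov_sum_right {d : ℕ} {A B : Mat d} (hA : A.IsHermitian) (hB : B.IsHermitian) (j : Fin d) :
    ∑ i, ‖ov hA hB j i‖ ^ 2 = 1 := by
  set U : Mat d := (hA.eigenvectorUnitary : Mat d)
  set V : Mat d := (hB.eigenvectorUnitary : Mat d)
  have h : (star V * U) * star (star V * U) = 1 := by
    rw [star_mul, star_star]
    calc star V * U * (star U * V) = star V * (U * star U) * V := by simp only [mul_assoc]
      _ = 1 := by rw [unit_mul_star hA, mul_one, unit_star_mul hB]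
  have h2 := congrFun (congrFun h j) j
  rw [Matrix.mul_apply, Matrix.one_apply_eq] at h2
  have h3 : ((∑ i, ‖ov hA hB j i‖ ^ 2 : ℝ) : ℂ) = 1 := by
    rw [← h2]; push_cast
    refine Finset.sum_congr rfl fun i _ => ?_
    rw [Matrix.star_apply]
    change _ = ov hA hB j i * star (ov hA hB j i)
    rw [← Complex.mul_conj']; rfl
  exact_mod_cast h3

lemma rtr_mul_comm {d : ℕ} (A B : Mat d) : rtr (A * B) = rtr (B * A) := by
  rw [rtr, rtr, Matrix.trace_mul_comm]

/-- trace of `A Yᴴ D Y`-like products in coordinates. -/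
lemma trace_diag_sandwich {d : ℕ} (Y : Mat d) (a b : Fin d → ℝ) :
    rtr (star Y * Matrix.diagonal (fun j => (b j : ℂ)) * Y * Matrix.diagonal (fun i => (a i : ℂ)))
      = ∑ j, ∑ i, ‖Y j i‖ ^ 2 * a i * b j := by
  have : (star Y * Matrix.diagonal (fun j => (b j : ℂ)) * Y *
      Matrix.diagonal (fun i => (a i : ℂ))).trace
      = ((∑ j, ∑ i, ‖Y j i‖ ^ 2 * a i * b j : ℝ) : ℂ) := by
    rw [Finset.sum_comm]
    simp only [Matrix.trace, Matrix.diag_apply]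
    push_cast
    refine Finset.sum_congr rfl fun i _ => ?_
    rw [Matrix.mul_diagonal, Matrix.mul_apply, Finset.sum_mul]
    refine Finset.sum_congr rfl fun j _ => ?_
    rw [Matrix.mul_diagonal, Matrix.star_apply, ← Complex.conj_mul']
    simp only [RCLike.star_def]
    ring
  rw [rtr, this, Complex.ofReal_re]

lemma rtr_mul_cfc {d : ℕ} {A B : Mat d} (hA : A.IsHermitian) (hB : B.IsHermitian) (f : ℝ → ℝ) :
    rtr (A * cfc f B) = ∑ j, ∑ i, ‖ov hA hB j i‖ ^ 2 * hA.eigenvalues i * f (hB.eigenvalues j) := by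
  set U : Mat d := (hA.eigenvectorUnitary : Mat d) with hU
  set V : Mat d := (hB.eigenvectorUnitary : Mat d) with hV
  have := trace_diag_sandwich (star V * U) hA.eigenvalues (fun j => f (hB.eigenvalues j))
  change _ = ∑ j, ∑ i, ‖(star V * U) j i‖ ^ 2 * _ * _
  rw [← this, star_mul, star_star, cfc_spec_eq hB f]
  conv_lhs => rw [spec_eq hA]
  rw [← hU, ← hV]
  rw [mul_assoc (U * _) (star U), rtr_mul_comm]
  simp only [mul_assoc]

lemma rtr_cfc {d : ℕ} {A : Mat d} (hA : A.IsHermitian) (f : ℝ → ℝ) :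
    rtr (cfc f A) = ∑ i, f (hA.eigenvalues i) := by
  rw [cfc_spec_eq hA, rtr, Matrix.trace_mul_comm, ← mul_assoc, unit_star_mul, one_mul,
    Matrix.trace_diagonal]
  simp

lemma rtr_eq_sum {d : ℕ} {A : Mat d} (hA : A.IsHermitian) :
    rtr A = ∑ i, hA.eigenvalues i := by
  rw [rtr, hA.trace_eq_sum_eigenvalues]; simp

lemma vnEnt_eq {d : ℕ} {A : Mat d} (hA : A.IsHermitian) :
    vnEnt A = ∑ i, negMulLog (hA.eigenvalues i) := by
  rw [vnEnt, dif_pos hA, ← Finset.sum_neg_distrib]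
  simp [negMulLog]

lemma vnEnt_eq_rtr {d : ℕ} {A : Mat d} (hA : A.IsHermitian) :
    vnEnt A = rtr (cfc negMulLog A) := by
  rw [vnEnt_eq hA, rtr_cfc hA]


/-- The quantum relative entropy `Tr A (log A - log B)`. -/
def qD {d : ℕ} (A B : Mat d) : ℝ := - vnEnt A - rtr (A * cfc Real.log B)

lemma qD_eq {d : ℕ} {A B : Mat d} (hA : A.IsHermitian) (hB : B.IsHermitian) :
    qD A B = ∑ j, ∑ i, ‖ov hA hB j i‖ ^ 2 *
      (hA.eigenvalues i * (Real.log (hA.eigenvalues i) - Real.log (hB.eigenvalues j))) := by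
  rw [qD, rtr_mul_cfc hA hB, vnEnt_eq hA]
  have : ∑ i, negMulLog (hA.eigenvalues i) =
      ∑ j, ∑ i, ‖ov hA hB j i‖ ^ 2 * negMulLog (hA.eigenvalues i) := by
    rw [Finset.sum_comm]
    refine Finset.sum_congr rfl fun i _ => ?_
    rw [← Finset.sum_mul, ov_sum_left, one_mul]
  rw [this, ← Finset.sum_neg_distrib, ← Finset.sum_sub_distrib]
  refine Finset.sum_congr rfl fun j _ => ?_
  rw [← Finset.sum_neg_distrib, ← Finset.sum_sub_distrib]
  refine Finset.sum_congr rfl fun i _ => ?_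
  rw [negMulLog]; ring

lemma rtr_eq_ov_left {d : ℕ} {A B : Mat d} (hA : A.IsHermitian) (hB : B.IsHermitian) :
    rtr A = ∑ j, ∑ i, ‖ov hA hB j i‖ ^ 2 * hA.eigenvalues i := by
  rw [rtr_eq_sum hA, Finset.sum_comm]
  refine Finset.sum_congr rfl fun i _ => ?_
  rw [← Finset.sum_mul, ov_sum_left, one_mul]

lemma rtr_eq_ov_right {d : ℕ} {A B : Mat d} (hA : A.IsHermitian) (hB : B.IsHermitian) :
    rtr B = ∑ j, ∑ i, ‖ov hA hB j i‖ ^ 2 * hB.eigenvalues j := by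
  rw [rtr_eq_sum hB]
  refine Finset.sum_congr rfl fun j _ => ?_
  rw [← Finset.sum_mul, ov_sum_right, one_mul]

/-- The quadratic functional in eigen-coordinates. -/
lemma quad_eq {d : ℕ} {A B : Mat d} (hA : A.IsHermitian) (hB : B.IsHermitian) (X : Mat d)
    (τ : ℝ) :
    rtr (A * (X + star X - (τ : ℂ) • (star X * X))) - rtr (B * (X * star X)) =
    ∑ j, ∑ i, (2 * (star ((star (hB.eigenvectorUnitary : Mat d) * X *
        (hA.eigenvectorUnitary : Mat d)) j i) * ov hA hB j i).re * hA.eigenvalues i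
      - (hB.eigenvalues j + τ * hA.eigenvalues i) *
        ‖(star (hB.eigenvectorUnitary : Mat d) * X * (hA.eigenvectorUnitary : Mat d)) j i‖ ^ 2) := by
  set U : Mat d := (hA.eigenvectorUnitary : Mat d) with hU
  set V : Mat d := (hB.eigenvectorUnitary : Mat d) with hV
  have hUU : star U * U = 1 := unit_star_mul hA
  have hUU' : U * star U = 1 := unit_mul_star hA
  have hVV : star V * V = 1 := unit_star_mul hB
  have hVV' : V * star V = 1 := unit_mul_star hB
  set Y : Mat d := star V * X * U with hY
  have hX : X = V * Y * star U := by
    rw [hY]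
    calc X = (V * star V) * X * (U * star U) := by rw [hVV', hUU']; simp
      _ = _ := by simp only [mul_assoc]
  have hXX : star X * X = U * (star Y * Y) * star U := by
    rw [hX, star_mul, star_mul, star_star]
    calc U * (star Y * star V) * (V * Y * star U)
        = U * star Y * (star V * V) * Y * star U := by simp only [mul_assoc]
      _ = _ := by rw [hVV]; simp only [mul_assoc, mul_one]
  have hXX' : X * star X = V * (Y * star Y) * star V := by
    rw [hX, star_mul, star_mul, star_star]
    calc V * Y * star U * (U * (star Y * star V))
        = V * Y * (star U * U) * star Y * star V := by simp only [mul_assoc]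
      _ = _ := by rw [hUU]; simp only [mul_assoc, mul_one]
  set a := hA.eigenvalues with ha
  set b := hB.eigenvalues with hb
  have e1 : rtr (A * (star X * X)) = ∑ j, ∑ i, ‖Y j i‖ ^ 2 * a i := by
    have := trace_diag_sandwich Y a (fun _ => 1)
    simp only [Complex.ofReal_one, Matrix.diagonal_one, mul_one] at this
    rw [← this, hXX]
    conv_lhs => rw [spec_eq hA]
    rw [← hU, mul_assoc (U * _) (star U), rtr_mul_comm]
    calc _ = rtr (star U * U * (star Y * Y) * (star U * U) * Matrix.diagonal fun i => (a i : ℂ)) := by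
          simp only [mul_assoc]; rfl
      _ = _ := by rw [hUU]; simp
  have e2 : rtr (B * (X * star X)) = ∑ j, ∑ i, ‖Y j i‖ ^ 2 * b j := by
    have := trace_diag_sandwich Y (fun _ => 1) b
    simp only [Complex.ofReal_one, Matrix.diagonal_one, mul_one] at this
    rw [← this, hXX']
    conv_lhs => rw [spec_eq hB]
    rw [← hV, rtr_mul_comm]
    calc _ = rtr (V * (Y * star Y * (star V * V) * (Matrix.diagonal fun i => (b i : ℂ)) * star V)) := by
          simp only [mul_assoc]; rfl
      _ = rtr (Y * (star Y * (Matrix.diagonal fun i => (b i : ℂ)) * (star V * V))) := by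
          rw [hVV, rtr_mul_comm]; simp only [mul_assoc, mul_one, hVV]
      _ = _ := by rw [hVV, rtr_mul_comm]; simp
  have e3 : rtr (A * star X) = ∑ j, ∑ i, (star (Y j i) * ov hA hB j i).re * a i := by
    have h1 : rtr (A * star X) = rtr (star Y * (star V * U) * Matrix.diagonal fun i => (a i : ℂ)) := by
      conv_lhs => rw [spec_eq hA, hX]
      rw [← hU, star_mul, star_mul, star_star, mul_assoc (U * _) (star U), rtr_mul_comm]
      calc _ = rtr ((star U * U) * star Y * (star V * U) * Matrix.diagonal fun i => (a i : ℂ)) := by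
            simp only [mul_assoc]; rfl
        _ = _ := by rw [hUU, one_mul]
    rw [h1, rtr, Finset.sum_comm]
    simp only [Matrix.trace, Matrix.diag_apply, Complex.re_sum]
    refine Finset.sum_congr rfl fun i _ => ?_
    rw [Matrix.mul_diagonal, Matrix.mul_apply, Finset.sum_mul, Complex.re_sum]
    refine Finset.sum_congr rfl fun j _ => ?_
    rw [Matrix.star_apply, Complex.re_mul_ofReal]; rfl
  have e4 : rtr (A * X) = rtr (A * star X) := by
    have : (A * star X).trace = star ((A * X).trace) := by
      rw [← Matrix.trace_conjTranspose, Matrix.conjTranspose_mul, hA.eq, Matrix.trace_mul_comm]; rfl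
    rw [rtr, rtr, this]; simp
  have e5 : rtr (A * (X + star X - (τ : ℂ) • (star X * X))) =
      rtr (A * X) + rtr (A * star X) - τ * rtr (A * (star X * X)) := by
    simp [rtr, mul_add, mul_sub]
  rw [e5, e4, e3, e1, e2, Finset.mul_sum, ← Finset.sum_add_distrib, ← Finset.sum_sub_distrib,
    ← Finset.sum_sub_distrib]
  refine Finset.sum_congr rfl fun j _ => ?_
  rw [Finset.mul_sum, ← Finset.sum_add_distrib, ← Finset.sum_sub_distrib,
    ← Finset.sum_sub_distrib]
  refine Finset.sum_congr rfl fun i _ => ?_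
  ring

lemma quad_le {d : ℕ} {A B : Mat d} (hA : A.PosSemidef) (hB : B.PosDef) (X : Mat d)
    {τ : ℝ} (hτ : 0 ≤ τ) :
    rtr (A * (X + star X - (τ : ℂ) • (star X * X))) - rtr (B * (X * star X)) ≤
    ∑ j, ∑ i, ‖ov hA.1 hB.1 j i‖ ^ 2 *
      (hA.1.eigenvalues i ^ 2 / (hB.1.eigenvalues j + τ * hA.1.eigenvalues i)) := by
  rw [quad_eq hA.1 hB.1]
  refine Finset.sum_le_sum fun j _ => Finset.sum_le_sum fun i _ => ?_
  set y := (star (hB.1.eigenvectorUnitary : Mat d) * X * (hA.1.eigenvectorUnitary : Mat d)) j i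
  set P := ov hA.1 hB.1 j i
  have ha := hA.eigenvalues_nonneg i
  have hb := hB.eigenvalues_pos j
  set a := hA.1.eigenvalues i
  set b := hB.1.eigenvalues j
  have hc : 0 < b + τ * a := by positivity
  have h1 : (star y * P).re ≤ ‖y‖ * ‖P‖ := by
    calc _ ≤ ‖star y * P‖ := Complex.re_le_norm _
      _ = _ := by rw [norm_mul, norm_star]
  rw [← mul_div_assoc, le_div_iff₀ hc]
  have h2 : 2 * (star y * P).re * a ≤ 2 * (‖y‖ * ‖P‖) * a := by gcongr
  have h3 := mul_le_mul_of_nonneg_right h2 hc.le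
  nlinarith [sq_nonneg (‖P‖ * a - (b + τ * a) * ‖y‖)]

end partA

section partB

/-- the optimizer -/
def optW {d : ℕ} {N M : Mat d} (hN : N.IsHermitian) (hM : M.IsHermitian) (τ : ℝ) : Mat d :=
  (hM.eigenvectorUnitary : Mat d) *
    Matrix.of (fun j i => ((hN.eigenvalues i / (hM.eigenvalues j + τ * hN.eigenvalues i) : ℝ) : ℂ)
      * ov hN hM j i) * star (hN.eigenvectorUnitary : Mat d)

lemma quad_optW {d : ℕ} {N M : Mat d} (hN : N.PosSemidef) (hM : M.PosDef) {τ : ℝ} (hτ : 0 ≤ τ) :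
    rtr (N * (optW hN.1 hM.1 τ + star (optW hN.1 hM.1 τ)
      - (τ : ℂ) • (star (optW hN.1 hM.1 τ) * optW hN.1 hM.1 τ)))
      - rtr (M * (optW hN.1 hM.1 τ * star (optW hN.1 hM.1 τ))) =
    ∑ j, ∑ i, ‖ov hN.1 hM.1 j i‖ ^ 2 *
      (hN.1.eigenvalues i ^ 2 / (hM.1.eigenvalues j + τ * hN.1.eigenvalues i)) := by
  rw [quad_eq hN.1 hM.1]
  have hY : star (hM.1.eigenvectorUnitary : Mat d) * optW hN.1 hM.1 τ *
      (hN.1.eigenvectorUnitary : Mat d) = Matrix.of (fun j i =>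
      ((hN.1.eigenvalues i / (hM.1.eigenvalues j + τ * hN.1.eigenvalues i) : ℝ) : ℂ)
      * ov hN.1 hM.1 j i) := by
    rw [optW]
    generalize (Matrix.of (fun j i =>
      ((hN.1.eigenvalues i / (hM.1.eigenvalues j + τ * hN.1.eigenvalues i) : ℝ) : ℂ)
      * ov hN.1 hM.1 j i)) = C
    calc _ = (star (hM.1.eigenvectorUnitary : Mat d) * (hM.1.eigenvectorUnitary : Mat d)) * C *
        (star (hN.1.eigenvectorUnitary : Mat d) * (hN.1.eigenvectorUnitary : Mat d)) := by
          simp only [mul_assoc]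
      _ = _ := by rw [unit_star_mul, unit_star_mul, one_mul, mul_one]
  rw [hY]
  refine Finset.sum_congr rfl fun j _ => Finset.sum_congr rfl fun i _ => ?_
  rw [Matrix.of_apply]
  have ha := hN.eigenvalues_nonneg i
  have hb := hM.eigenvalues_pos j
  set a := hN.1.eigenvalues i
  set b := hM.1.eigenvalues j
  set P := ov hN.1 hM.1 j i
  have hc : 0 < b + τ * a := by positivity
  have h1 : (star (((a / (b + τ * a) : ℝ) : ℂ) * P) * P).re = a / (b + τ * a) * ‖P‖ ^ 2 := by
    have : star (((a / (b + τ * a) : ℝ) : ℂ) * P) * P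
        = ((a / (b + τ * a) * ‖P‖ ^ 2 : ℝ) : ℂ) := by
      push_cast
      rw [← Complex.conj_mul']
      simp only [star_mul', RCLike.star_def, Complex.conj_ofReal, map_div₀, map_add, map_mul]
      ring
    rw [this, Complex.ofReal_re]
  have h2 : ‖((a / (b + τ * a) : ℝ) : ℂ) * P‖ ^ 2 = (a / (b + τ * a)) ^ 2 * ‖P‖ ^ 2 := by
    rw [norm_mul, mul_pow, Complex.norm_real, Real.norm_eq_abs, sq_abs]
  rw [h1, h2]
  field_simp
  ring

lemma integral_scalar {a b T : ℝ} (ha : 0 ≤ a) (hb : 0 < b) (hT : 0 ≤ T) :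
    ∫ τ in (0:ℝ)..T, (a ^ 2 / (b + τ * a) - a / (1 + τ)) =
      a * (Real.log (b + T * a) - Real.log b - Real.log (1 + T)) := by
  have hd : ∀ τ ∈ Set.uIcc 0 T, HasDerivAt
      (fun τ => a * (Real.log (b + τ * a) - Real.log b - Real.log (1 + τ)))
      (a ^ 2 / (b + τ * a) - a / (1 + τ)) τ := by
    intro τ hτ
    rw [Set.uIcc_of_le hT] at hτ
    have h0 : 0 ≤ τ := hτ.1
    have h1 : 0 < b + τ * a := by positivity
    have h2 : 0 < 1 + τ := by positivity
    have e1 : HasDerivAt (fun τ : ℝ => Real.log (b + τ * a)) (a / (b + τ * a)) τ := by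
      have := (((hasDerivAt_id τ).mul_const a).const_add b).log h1.ne'
      simpa using this
    have e2 : HasDerivAt (fun τ : ℝ => Real.log (1 + τ)) (1 / (1 + τ)) τ := by
      have := ((hasDerivAt_id τ).const_add 1).log h2.ne'
      simpa using this
    have := ((e1.sub_const (Real.log b)).sub e2).const_mul a
    refine this.congr_deriv ?_
    ring
  rw [intervalIntegral.integral_eq_sub_of_hasDerivAt hd]
  · simp
  · apply ContinuousOn.intervalIntegrable
    rw [Set.uIcc_of_le hT]
    apply ContinuousOn.sub
    · apply ContinuousOn.div (by fun_prop) (by fun_prop)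
      intro τ hτ
      have h0 : 0 ≤ τ := hτ.1
      positivity
    · apply ContinuousOn.div (by fun_prop) (by fun_prop)
      intro τ hτ
      have h0 : 0 ≤ τ := hτ.1
      positivity

lemma integral_double_sum {d : ℕ} {N M : Mat d} (hN : N.PosSemidef) (hM : M.PosDef) {T : ℝ}
    (hT : 0 ≤ T) :
    IntervalIntegrable (fun τ : ℝ => ∑ j, ∑ i, ‖ov hN.1 hM.1 j i‖ ^ 2 *
      (hN.1.eigenvalues i ^ 2 / (hM.1.eigenvalues j + τ * hN.1.eigenvalues i)
        - hN.1.eigenvalues i / (1 + τ))) volume 0 T ∧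
    ∫ τ in (0:ℝ)..T, ∑ j, ∑ i, ‖ov hN.1 hM.1 j i‖ ^ 2 *
      (hN.1.eigenvalues i ^ 2 / (hM.1.eigenvalues j + τ * hN.1.eigenvalues i)
        - hN.1.eigenvalues i / (1 + τ)) =
    ∑ j, ∑ i, ‖ov hN.1 hM.1 j i‖ ^ 2 * (hN.1.eigenvalues i *
      (Real.log (hM.1.eigenvalues j + T * hN.1.eigenvalues i)
        - Real.log (hM.1.eigenvalues j) - Real.log (1 + T))) := by
  have hc : ∀ j i, IntervalIntegrable (fun τ : ℝ => ‖ov hN.1 hM.1 j i‖ ^ 2 *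
      (hN.1.eigenvalues i ^ 2 / (hM.1.eigenvalues j + τ * hN.1.eigenvalues i)
        - hN.1.eigenvalues i / (1 + τ))) volume 0 T := by
    intro j i
    have ha := hN.eigenvalues_nonneg i
    have hb := hM.eigenvalues_pos j
    apply ContinuousOn.intervalIntegrable
    rw [Set.uIcc_of_le hT]
    apply ContinuousOn.mul (by fun_prop)
    apply ContinuousOn.sub
    · apply ContinuousOn.div (by fun_prop) (by fun_prop)
      intro τ hτ
      have h0 : 0 ≤ τ := hτ.1
      positivity
    · apply ContinuousOn.div (by fun_prop) (by fun_prop)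
      intro τ hτ
      have h0 : 0 ≤ τ := hτ.1
      positivity
  have hc2 : ∀ j, IntervalIntegrable (fun τ : ℝ => ∑ i, ‖ov hN.1 hM.1 j i‖ ^ 2 *
      (hN.1.eigenvalues i ^ 2 / (hM.1.eigenvalues j + τ * hN.1.eigenvalues i)
        - hN.1.eigenvalues i / (1 + τ))) volume 0 T := by
    intro j
    have := IntervalIntegrable.sum Finset.univ (fun i _ => hc j i)
    exact this.congr_ae (Eventually.of_forall fun τ => by simp)
  refine ⟨?_, ?_⟩
  · have := IntervalIntegrable.sum Finset.univ (fun j _ => hc2 j)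
    exact this.congr_ae (Eventually.of_forall fun τ => by simp)
  · rw [intervalIntegral.integral_finsetSum (fun j _ => hc2 j)]
    refine Finset.sum_congr rfl fun j _ => ?_
    rw [intervalIntegral.integral_finsetSum (fun i _ => hc j i)]
    refine Finset.sum_congr rfl fun i _ => ?_
    rw [intervalIntegral.integral_const_mul, integral_scalar (hN.eigenvalues_nonneg i)
      (hM.eigenvalues_pos j) hT]

lemma optW_cont {d : ℕ} {N M : Mat d} (hN : N.PosSemidef) (hM : M.PosDef) :
    ContinuousOn (optW hN.1 hM.1) (Set.Ici 0) := by
  unfold optW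
  apply ContinuousOn.mul _ continuousOn_const
  apply ContinuousOn.mul continuousOn_const
  refine continuousOn_pi.2 fun j => continuousOn_pi.2 fun i => ?_
  change ContinuousOn (fun τ : ℝ =>
    ((hN.1.eigenvalues i / (hM.1.eigenvalues j + τ * hN.1.eigenvalues i) : ℝ) : ℂ)
      * ov hN.1 hM.1 j i) _
  apply ContinuousOn.mul _ continuousOn_const
  apply Complex.continuous_ofReal.comp_continuousOn
  apply ContinuousOn.div (by fun_prop) (by fun_prop)
  intro τ hτ
  have h0 : 0 ≤ τ := hτ
  have ha := hN.eigenvalues_nonneg i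
  have hb := hM.eigenvalues_pos j
  positivity

/-- Truncated tangent functional for the relative entropy. -/
lemma tangent {d : ℕ} {N M : Mat d} (hN : N.PosSemidef) (hM : M.PosDef) {T : ℝ} (hT : 0 ≤ T) :
    ∃ K L : Mat d, (∀ A B : Mat d, A.PosSemidef → B.PosDef →
      rtr (A * K) - rtr (B * L) ≤ qD A B + (rtr B - rtr A) / (1 + T)) ∧
      rtr (N * K) - rtr (M * L) = ∑ j, ∑ i, ‖ov hN.1 hM.1 j i‖ ^ 2 * (hN.1.eigenvalues i *
      (Real.log (hM.1.eigenvalues j + T * hN.1.eigenvalues i)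
        - Real.log (hM.1.eigenvalues j) - Real.log (1 + T))) := by
  set W := optW hN.1 hM.1 with hW
  have hWc : ContinuousOn W (Set.uIcc 0 T) := by
    rw [Set.uIcc_of_le hT]; exact (optW_cont hN hM).mono Set.Icc_subset_Ici_self
  set Kf : ℝ → Mat d := fun τ => W τ + star (W τ) - (τ : ℂ) • (star (W τ) * W τ)
    - ((1 / (1 + τ) : ℝ) : ℂ) • (1 : Mat d) with hKf
  set Lf : ℝ → Mat d := fun τ => W τ * star (W τ) with hLf
  have hKc : IntervalIntegrable Kf volume 0 T := by
    apply ContinuousOn.intervalIntegrable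
    have : ContinuousOn (fun τ : ℝ => ((1 / (1 + τ) : ℝ) : ℂ)) (Set.uIcc 0 T) := by
      apply Complex.continuous_ofReal.comp_continuousOn
      apply ContinuousOn.div (by fun_prop) (by fun_prop)
      intro τ hτ
      rw [Set.uIcc_of_le hT] at hτ
      have h0 : 0 ≤ τ := hτ.1
      positivity
    have h2 : ContinuousOn (fun τ : ℝ => (τ : ℂ)) (Set.uIcc 0 T) := by fun_prop
    exact ((hWc.add hWc.star).sub (h2.smul (hWc.star.mul hWc))).sub (this.smul continuousOn_const)
  have hLc : IntervalIntegrable Lf volume 0 T := by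
    apply ContinuousOn.intervalIntegrable
    exact hWc.mul hWc.star
  have key : ∀ A B : Mat d, rtr (A * ∫ τ in (0:ℝ)..T, Kf τ) - rtr (B * ∫ τ in (0:ℝ)..T, Lf τ)
      = ∫ τ in (0:ℝ)..T, (rtr (A * Kf τ) - rtr (B * Lf τ)) := by
    intro A B
    have h1 : ∀ (A : Mat d) (F : ℝ → Mat d), IntervalIntegrable F volume 0 T →
        rtr (A * ∫ τ in (0:ℝ)..T, F τ) = ∫ τ in (0:ℝ)..T, rtr (A * F τ) ∧
        IntervalIntegrable (fun τ => rtr (A * F τ)) volume 0 T := by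
      intro A F hF
      have e : ∀ X, rtr (A * X) = rtrMulL A X := fun X => by rw [rtrMulL_apply, rtr_mul_comm]
      simp only [e]
      refine ⟨(ContinuousLinearMap.intervalIntegral_comp_comm _ hF).symm, ?_⟩
      exact ⟨(rtrMulL A).integrable_comp hF.1, (rtrMulL A).integrable_comp hF.2⟩
    rw [(h1 A Kf hKc).1, (h1 B Lf hLc).1,
      intervalIntegral.integral_sub (h1 A Kf hKc).2 (h1 B Lf hLc).2]
  have keyI : ∀ A B : Mat d, IntervalIntegrable (fun τ => rtr (A * Kf τ) - rtr (B * Lf τ)) volume 0 T := by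
    intro A B
    have e : ∀ A X : Mat d, rtr (A * X) = rtrMulL A X := fun A X => by rw [rtrMulL_apply, rtr_mul_comm]
    simp only [e]
    exact ⟨((rtrMulL A).integrable_comp hKc.1).sub ((rtrMulL B).integrable_comp hLc.1),
      ((rtrMulL A).integrable_comp hKc.2).sub ((rtrMulL B).integrable_comp hLc.2)⟩
  have split : ∀ A B : Mat d, ∀ τ, rtr (A * Kf τ) - rtr (B * Lf τ) =
      (rtr (A * (W τ + star (W τ) - (τ : ℂ) • (star (W τ) * W τ))) - rtr (B * (W τ * star (W τ))))
        - rtr A / (1 + τ) := by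
    intro A B τ
    simp only [hKf, hLf, mul_sub (A) _ (((1 / (1 + τ) : ℝ) : ℂ) • (1 : Mat d))]
    have : ∀ X Y : Mat d, rtr (X - Y) = rtr X - rtr Y := by intro X Y; simp [rtr]
    rw [this]
    have h3 : rtr (A * (((1 / (1 + τ) : ℝ) : ℂ) • (1 : Mat d))) = rtr A / (1 + τ) := by
      rw [mul_smul_comm, mul_one, rtr, Matrix.trace_smul, smul_eq_mul, Complex.re_ofReal_mul, rtr]
      ring
    rw [h3]; ring
  have dsum : ∀ A B : Mat d, ∀ (hA : A.PosSemidef) (hB : B.PosDef), ∀ τ : ℝ,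
      ∑ j, ∑ i, ‖ov hA.1 hB.1 j i‖ ^ 2 *
      (hA.1.eigenvalues i ^ 2 / (hB.1.eigenvalues j + τ * hA.1.eigenvalues i)) - rtr A / (1 + τ)
      = ∑ j, ∑ i, ‖ov hA.1 hB.1 j i‖ ^ 2 *
      (hA.1.eigenvalues i ^ 2 / (hB.1.eigenvalues j + τ * hA.1.eigenvalues i)
        - hA.1.eigenvalues i / (1 + τ)) := by
    intro A B hA hB τ
    rw [rtr_eq_ov_left hA.1 hB.1, Finset.sum_div, ← Finset.sum_sub_distrib]
    refine Finset.sum_congr rfl fun j _ => ?_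
    rw [Finset.sum_div, ← Finset.sum_sub_distrib]
    refine Finset.sum_congr rfl fun i _ => ?_
    ring
  refine ⟨∫ τ in (0:ℝ)..T, Kf τ, ∫ τ in (0:ℝ)..T, Lf τ, ?_, ?_⟩
  · intro A B hA hB
    rw [key]
    calc ∫ τ in (0:ℝ)..T, (rtr (A * Kf τ) - rtr (B * Lf τ))
        ≤ ∫ τ in (0:ℝ)..T, ∑ j, ∑ i, ‖ov hA.1 hB.1 j i‖ ^ 2 *
      (hA.1.eigenvalues i ^ 2 / (hB.1.eigenvalues j + τ * hA.1.eigenvalues i)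
        - hA.1.eigenvalues i / (1 + τ)) := by
          apply intervalIntegral.integral_mono_on hT (keyI A B) (integral_double_sum hA hB hT).1
          intro τ hτ
          rw [split, ← dsum A B hA hB]
          exact sub_le_sub_right (quad_le hA hB _ hτ.1) _
      _ = _ := (integral_double_sum hA hB hT).2
      _ ≤ _ := by
          rw [qD_eq hA.1 hB.1, rtr_eq_ov_left hA.1 hB.1, rtr_eq_ov_right hA.1 hB.1,
            ← Finset.sum_sub_distrib, Finset.sum_div, ← Finset.sum_add_distrib]
          refine Finset.sum_le_sum fun j _ => ?_
          rw [← Finset.sum_sub_distrib, Finset.sum_div, ← Finset.sum_add_distrib]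
          refine Finset.sum_le_sum fun i _ => ?_
          rw [← mul_sub, mul_div_assoc, ← mul_add]
          apply mul_le_mul_of_nonneg_left _ (by positivity)
          have ha := hA.eigenvalues_nonneg i
          have hb := hB.eigenvalues_pos j
          set a := hA.1.eigenvalues i
          set b := hB.1.eigenvalues j
          rcases ha.eq_or_lt with h0 | h0
          · rw [← h0]; simp; positivity
          · have hx : Real.log ((b + T * a) / (a * (1 + T))) ≤ (b + T * a) / (a * (1 + T)) - 1 :=
              Real.log_le_sub_one_of_pos (by positivity)
            rw [Real.log_div (by positivity) (by positivity),
              Real.log_mul (by positivity) (by positivity)] at hx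
            have := mul_le_mul_of_nonneg_left hx ha
            have e : a * ((b + T * a) / (a * (1 + T)) - 1) = (b - a) / (1 + T) := by
              field_simp; ring
            rw [e] at this
            nlinarith
  · rw [key, ← (integral_double_sum hN hM hT).2]
    apply intervalIntegral.integral_congr
    intro τ hτ
    rw [Set.uIcc_of_le hT] at hτ
    simp only
    rw [split, ← dsum N M hN hM, ← quad_optW hN hM hτ.1]

end partB

section partC

lemma subadd_limit {d : ℕ} {N M : Mat d} (hN : N.PosSemidef) (hM : M.PosDef) :
    Tendsto (fun T : ℝ => ∑ j, ∑ i, ‖ov hN.1 hM.1 j i‖ ^ 2 * (hN.1.eigenvalues i *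
      (Real.log (hM.1.eigenvalues j + T * hN.1.eigenvalues i)
        - Real.log (hM.1.eigenvalues j) - Real.log (1 + T)))) atTop (𝓝 (qD N M)) := by
  rw [qD_eq hN.1 hM.1]
  refine tendsto_finsetSum _ fun j _ => tendsto_finsetSum _ fun i _ => ?_
  apply Tendsto.const_mul
  have ha := hN.eigenvalues_nonneg i
  have hb := hM.eigenvalues_pos j
  set a := hN.1.eigenvalues i
  set b := hM.1.eigenvalues j
  rcases ha.eq_or_lt with h0 | h0
  · rw [← h0]; simp
  · apply Tendsto.const_mul
    have h1 : Tendsto (fun T : ℝ => a + (b - a) / (1 + T)) atTop (𝓝 (a + 0)) :=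
      tendsto_const_nhds.add (tendsto_const_nhds.div_atTop
        (tendsto_atTop_add_const_left _ _ tendsto_id))
    rw [add_zero] at h1
    have h2 := (h1.log h0.ne').sub_const (Real.log b)
    refine h2.congr' ?_
    filter_upwards [eventually_ge_atTop 0] with T hT
    have e : a + (b - a) / (1 + T) = (b + T * a) / (1 + T) := by field_simp; ring
    rw [e, Real.log_div (by positivity) (by positivity)]
    ring

lemma rtr_sub {d : ℕ} (X Y : Mat d) : rtr (X - Y) = rtr X - rtr Y := by simp [rtr]
lemma rtr_add {d : ℕ} (X Y : Mat d) : rtr (X + Y) = rtr X + rtr Y := by simp [rtr]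
lemma rtr_smul {d : ℕ} (c : ℝ) (X : Mat d) : rtr (c • X) = c * rtr X := by simp [rtr]
@[simp] lemma rtr_zero {d : ℕ} : rtr (0 : Mat d) = 0 := by simp [rtr]
@[simp] lemma rtr_one {d : ℕ} : rtr (1 : Mat d) = d := by simp [rtr]

/-- Joint convexity (subadditivity) of the relative entropy, integral form. -/
lemma subadd {d : ℕ} {β : Type*} [MeasurableSpace β] {μ : Measure β} {A B : β → Mat d}
    (hA : ∀ b, (A b).PosSemidef) (hB : ∀ b, (B b).PosDef)
    (hAi : Integrable A μ) (hBi : Integrable B μ) (hq : Integrable (fun b => qD (A b) (B b)) μ)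
    (hN : (∫ b, A b ∂μ).PosSemidef) (hM : (∫ b, B b ∂μ).PosDef) :
    qD (∫ b, A b ∂μ) (∫ b, B b ∂μ) ≤ ∫ b, qD (A b) (B b) ∂μ := by
  set N := ∫ b, A b ∂μ with hNd
  set M := ∫ b, B b ∂μ with hMd
  have h1 : Tendsto (fun T : ℝ => (∫ b, qD (A b) (B b) ∂μ) + (rtr M - rtr N) / (1 + T)) atTop
      (𝓝 ((∫ b, qD (A b) (B b) ∂μ) + 0)) :=
      tendsto_const_nhds.add (tendsto_const_nhds.div_atTop
        (tendsto_atTop_add_const_left _ _ tendsto_id))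
  rw [add_zero] at h1
  refine le_of_tendsto_of_tendsto (subadd_limit hN hM) h1 ?_
  filter_upwards [eventually_ge_atTop 0] with T hT
  obtain ⟨K, L, h, he⟩ := tangent hN hM hT
  rw [← he]
  have eK : rtr (N * K) = ∫ b, rtr (A b * K) ∂μ :=
    ((rtrMulL K).integral_comp_comm hAi).symm
  have eL : rtr (M * L) = ∫ b, rtr (B b * L) ∂μ :=
    ((rtrMulL L).integral_comp_comm hBi).symm
  have eN : rtr N = ∫ b, rtr (A b) ∂μ := by
    have := (rtrL (d := d)).integral_comp_comm hAi
    simpa using this.symm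
  have eM : rtr M = ∫ b, rtr (B b) ∂μ := by
    have := (rtrL (d := d)).integral_comp_comm hBi
    simpa using this.symm
  have iK : Integrable (fun b => rtr (A b * K)) μ := (rtrMulL K).integrable_comp hAi
  have iL : Integrable (fun b => rtr (B b * L)) μ := (rtrMulL L).integrable_comp hBi
  have iN : Integrable (fun b => rtr (A b)) μ := by
    simpa using (rtrL (d := d)).integrable_comp hAi
  have iM : Integrable (fun b => rtr (B b)) μ := by
    simpa using (rtrL (d := d)).integrable_comp hBi
  have iMN : Integrable (fun b => rtr (B b) - rtr (A b)) μ := iM.sub iN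
  rw [eK, eL, eN, eM, ← integral_sub iK iL, ← integral_sub iM iN, ← integral_div,
    ← integral_add hq (iMN.div_const _)]
  exact integral_mono (iK.sub iL) (hq.add ((iM.sub iN).div_const _)) (fun b => h _ _ (hA b) (hB b))

/-- Klein inequality. -/
lemma klein {d : ℕ} {A B : Mat d} (hA : A.PosSemidef) (hB : B.PosDef) :
    rtr A - rtr B ≤ qD A B := by
  rw [qD_eq hA.1 hB.1, rtr_eq_ov_left hA.1 hB.1, rtr_eq_ov_right hA.1 hB.1,
    ← Finset.sum_sub_distrib]
  refine Finset.sum_le_sum fun j _ => ?_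
  rw [← Finset.sum_sub_distrib]
  refine Finset.sum_le_sum fun i _ => ?_
  rw [← mul_sub]
  apply mul_le_mul_of_nonneg_left _ (by positivity)
  have ha := hA.eigenvalues_nonneg i
  have hb := hB.eigenvalues_pos j
  set a := hA.1.eigenvalues i
  set b := hB.1.eigenvalues j
  rcases ha.eq_or_lt with h0 | h0
  · rw [← h0]; simp [hb.le]
  · have hx : Real.log (b / a) ≤ b / a - 1 := Real.log_le_sub_one_of_pos (by positivity)
    rw [Real.log_div (by positivity) (by positivity)] at hx
    have := mul_le_mul_of_nonneg_left hx ha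
    have e : a * (b / a - 1) = b - a := by field_simp
    linarith

/-! ### entropy bounds for one matrix -/

lemma rtr_nonneg {d : ℕ} {A : Mat d} (hA : A.PosSemidef) : 0 ≤ rtr A := by
  rw [rtr_eq_sum hA.1]; exact Finset.sum_nonneg fun i _ => hA.eigenvalues_nonneg i

lemma eig_le {d : ℕ} {A : Mat d} (hA : A.PosSemidef) (i : Fin d) :
    hA.1.eigenvalues i ≤ rtr A := by
  rw [rtr_eq_sum hA.1]
  exact Finset.single_le_sum (f := hA.1.eigenvalues) (fun i _ => hA.eigenvalues_nonneg i)
    (Finset.mem_univ i)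

lemma vn_bounds {d : ℕ} {A : Mat d} (hA : A.PosSemidef) :
    -(rtr A * Real.log (rtr A)) ≤ vnEnt A ∧
      vnEnt A ≤ -(rtr A * Real.log (rtr A)) + d * rtr A := by
  have ht := rtr_nonneg hA
  have hle := eig_le hA
  have e : rtr A * Real.log (rtr A) = ∑ i, hA.1.eigenvalues i * Real.log (rtr A) := by
    rw [← Finset.sum_mul, ← rtr_eq_sum hA.1]
  rw [vnEnt_eq hA.1, e, ← Finset.sum_neg_distrib]
  constructor
  · refine Finset.sum_le_sum fun i _ => ?_
    have ha := hA.eigenvalues_nonneg i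
    rw [negMulLog]
    rcases ha.eq_or_lt with h0 | h0
    · rw [← h0]; simp
    · have := Real.log_le_log h0 (hle i)
      nlinarith
  · have : (d : ℝ) * rtr A = ∑ _i : Fin d, rtr A := by simp
    rw [this, ← Finset.sum_add_distrib]
    refine Finset.sum_le_sum fun i _ => ?_
    have ha := hA.eigenvalues_nonneg i
    have hl := hle i
    set a := hA.1.eigenvalues i
    rw [negMulLog]
    rcases ha.eq_or_lt with h0 | h0
    · rw [← h0]; simp [ht]
    · have htp : 0 < rtr A := lt_of_lt_of_le h0 hl
      have hx : Real.log (rtr A / a) ≤ rtr A / a - 1 := Real.log_le_sub_one_of_pos (by positivity)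
      rw [Real.log_div (by positivity) (by positivity)] at hx
      have := mul_le_mul_of_nonneg_left hx ha
      have e : a * (rtr A / a - 1) = rtr A - a := by field_simp
      linarith

lemma norm_le_rtr {d : ℕ} {A : Mat d} (hA : A.PosSemidef) : ‖A‖ ≤ rtr A := by
  conv_lhs => rw [spec_eq hA.1]
  have : star (hA.1.eigenvectorUnitary : Mat d) = ((star hA.1.eigenvectorUnitary : unitary (Mat d)) : Mat d) := rfl
  rw [this, CStarRing.norm_mul_coe_unitary, CStarRing.norm_coe_unitary_mul,
    Matrix.l2_opNorm_diagonal]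
  rw [pi_norm_le_iff_of_nonneg (rtr_nonneg hA)]
  intro i
  rw [Complex.norm_real, Real.norm_eq_abs, abs_of_nonneg (hA.eigenvalues_nonneg i)]
  exact eig_le hA i

lemma entry_le_norm {d : ℕ} (A : Mat d) (i j : Fin d) : ‖A i j‖ ≤ ‖A‖ := by
  have := Matrix.l2_opNorm_mulVec A (WithLp.toLp 2 (Pi.single j 1))
  simp only [EuclideanSpace.norm_single, EuclideanSpace.toLp_single, norm_one, mul_one] at this
  refine le_trans ?_ this
  refine le_trans (le_of_eq ?_) (PiLp.norm_apply_le _ i)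
  simp

lemma eq_zero_of_rtr {d : ℕ} {A : Mat d} (hA : A.PosSemidef) (h : rtr A = 0) : A = 0 := by
  have := norm_le_rtr hA
  rw [h] at this
  exact norm_le_zero_iff.1 this

/-! ### measurability -/

lemma continuous_cfc_herm {d : ℕ} {f : ℝ → ℝ} (hf : Continuous f) :
    Continuous (fun A : Mat d => cfc f ((1 / 2 : ℝ) • (A + star A))) := by
  have hsa : ∀ A : Mat d, IsSelfAdjoint ((1 / 2 : ℝ) • (A + star A)) := by
    intro A
    rw [isSelfAdjoint_iff, star_smul, star_add, star_star, add_comm]; simp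
  refine Continuous.cfc_of_mem_nhdsSet (s := Set.univ) f (by simp) (by fun_prop) hsa
    hf.continuousOn

lemma herm_half {d : ℕ} {A : Mat d} (hA : A.IsHermitian) : (1 / 2 : ℝ) • (A + star A) = A := by
  have : star A = A := hA
  rw [this, ← two_smul ℝ A, smul_smul]; norm_num

lemma sm_cfc {d : ℕ} {α : Type*} [MeasurableSpace α] {R : α → Mat d} (hR : StronglyMeasurable R)
    (hh : ∀ a, (R a).IsHermitian) {f : ℝ → ℝ} (hf : Continuous f) :
    StronglyMeasurable (fun a => cfc f (R a)) := by
  have := (continuous_cfc_herm hf).comp_stronglyMeasurable hR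
  have e : (fun x => cfc f ((1 / 2 : ℝ) • (R x + star (R x)))) = fun a => cfc f (R a) := by
    ext1 a; rw [herm_half (hh a)]
  rwa [e] at this

lemma sm_cfc_log {d : ℕ} {α : Type*} [MeasurableSpace α] {R : α → Mat d}
    (hR : StronglyMeasurable R) (hh : ∀ a, (R a).IsHermitian) :
    StronglyMeasurable (fun a => cfc Real.log (R a)) := by
  set f : ℕ → ℝ → ℝ := fun k x => x ^ 2 / (x ^ 2 + 1 / (k + 1)) *
    (Real.log (x ^ 2 + 1 / (k + 1)) / 2) with hf
  have hpos : ∀ (k : ℕ) (x : ℝ), 0 < x ^ 2 + 1 / ((k : ℝ) + 1) := fun k x => by positivity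
  have hc : ∀ k, Continuous (f k) := fun k => by
    have h1 : Continuous fun x : ℝ => x ^ 2 + 1 / ((k : ℝ) + 1) := by fun_prop
    exact ((by fun_prop : Continuous fun x : ℝ => x ^ 2).div h1 (fun x => (hpos k x).ne')).mul
      ((h1.log (fun x => (hpos k x).ne')).div_const _)
  have hl : ∀ x, Tendsto (fun k => f k x) atTop (𝓝 (Real.log x)) := by
    intro x
    rcases eq_or_ne x 0 with h0 | h0
    · subst h0; simp [hf]
    · have h1 : Tendsto (fun k : ℕ => x ^ 2 + 1 / ((k : ℝ) + 1)) atTop (𝓝 (x ^ 2 + 0)) :=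
        tendsto_const_nhds.add tendsto_one_div_add_atTop_nhds_zero_nat
      rw [add_zero] at h1
      have hx : x ^ 2 ≠ 0 := by positivity
      have h2 := ((tendsto_const_nhds (x := x ^ 2)).div h1 hx).mul ((h1.log hx).div_const 2)
      have e : x ^ 2 / x ^ 2 * (Real.log (x ^ 2) / 2) = Real.log x := by
        rw [div_self hx, Real.log_pow]; push_cast; ring
      rw [e] at h2
      exact h2
  refine stronglyMeasurable_of_tendsto atTop (fun k => sm_cfc hR hh (hc k)) ?_
  rw [tendsto_pi_nhds]
  intro a
  simp only [cfc_spec_eq (hh a)]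
  apply Tendsto.mul_const
  apply Tendsto.const_mul
  have : Continuous (fun v : Fin d → ℂ => (Matrix.diagonal v : Mat d)) :=
    Continuous.matrix_diagonal continuous_id
  refine (this.tendsto _).comp ?_
  rw [tendsto_pi_nhds]
  intro i
  exact (Complex.continuous_ofReal.tendsto _).comp (hl _)

lemma sm_vn {d : ℕ} {α : Type*} [MeasurableSpace α] {R : α → Mat d} (hR : StronglyMeasurable R)
    (hh : ∀ a, (R a).IsHermitian) : StronglyMeasurable (fun a => vnEnt (R a)) := by
  have := (rtrL (d := d)).continuous.comp_stronglyMeasurable (sm_cfc hR hh continuous_negMulLog)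
  have e : (fun a => (rtrL (d := d)) (cfc negMulLog (R a))) = fun a => vnEnt (R a) := by
    ext a; simp [vnEnt_eq_rtr (hh a)]
  rwa [e] at this

lemma sm_rtr {d : ℕ} {α : Type*} [MeasurableSpace α] {R : α → Mat d} (hR : StronglyMeasurable R) :
    StronglyMeasurable (fun a => rtr (R a)) := by
  simpa [Function.comp_def] using (rtrL (d := d)).continuous.comp_stronglyMeasurable hR

lemma sm_rtr_mul {d : ℕ} {α : Type*} [MeasurableSpace α] {R K : α → Mat d}
    (hR : StronglyMeasurable R) (hK : StronglyMeasurable K) :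
    StronglyMeasurable (fun a => rtr (R a * K a)) := sm_rtr (hR.mul hK)

lemma integrable_of_rtr {d : ℕ} {α : Type*} [MeasurableSpace α] {μ : Measure α} {R : α → Mat d}
    (hR : StronglyMeasurable R) (hp : ∀ a, (R a).PosSemidef)
    (hi : Integrable (fun a => rtr (R a)) μ) : Integrable R μ := by
  refine hi.mono' hR.aestronglyMeasurable (Eventually.of_forall fun a => norm_le_rtr (hp a))

lemma entry_integral {d : ℕ} {α : Type*} [MeasurableSpace α] {μ : Measure α} {R : α → Mat d}
    (hR : Integrable R μ) (i j : Fin d) : (∫ a, R a ∂μ) i j = ∫ a, R a i j ∂μ := by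
  let L : Mat d →L[ℂ] ℂ := LinearMap.toContinuousLinearMap
    { toFun := fun A => A i j
      map_add' := by intro A B; simp
      map_smul' := by intro c A; simp }
  exact (L.integral_comp_comm hR).symm

lemma psd_integral {d : ℕ} {α : Type*} [MeasurableSpace α] {μ : Measure α} {R : α → Mat d}
    (hp : ∀ a, (R a).PosSemidef) : (∫ a, R a ∂μ).PosSemidef := by
  by_cases hR : Integrable R μ
  · rw [Matrix.posSemidef_iff_dotProduct_mulVec]
    constructor
    · have h := (starL' ℝ (A := Mat d)).toContinuousLinearMap.integral_comp_comm hR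
      have e : ∀ a, (starL' ℝ (A := Mat d)).toContinuousLinearMap (R a) = R a := fun a => (hp a).1
      simp only [e] at h
      exact h.symm
    · intro x
      let L : Mat d →L[ℂ] ℂ := LinearMap.toContinuousLinearMap
        { toFun := fun A => star x ⬝ᵥ (A.mulVec x)
          map_add' := by intro A B; rw [Matrix.add_mulVec, dotProduct_add]
          map_smul' := by intro c A; rw [Matrix.smul_mulVec, dotProduct_smul]; rfl }
      have h := L.integral_comp_comm hR
      change 0 ≤ L (∫ a, R a ∂μ)
      rw [← h]
      have hn : ∀ a, 0 ≤ L (R a) := fun a => (hp a).dotProduct_mulVec_nonneg x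
      have hL := L.integrable_comp hR
      rw [Complex.le_def]
      constructor
      · have := Complex.reCLM.integral_comp_comm hL
        simp only [Complex.reCLM_apply] at this
        rw [← this]
        exact integral_nonneg fun a => (Complex.le_def.1 (hn a)).1
      · have := Complex.imCLM.integral_comp_comm hL
        simp only [Complex.imCLM_apply] at this
        rw [← this]
        rw [integral_congr_ae (g := fun _ => (0:ℝ))
          (Eventually.of_forall fun a => (Complex.le_def.1 (hn a)).2.symm)]
        simp
  · rw [integral_undef hR]; exact Matrix.PosSemidef.zero

end partC

section partD

/-! ### finite entropy class -/

/-- Matrix densities with finite trace and finite entropy. -/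
structure FE {d : ℕ} {α : Type*} [MeasurableSpace α] (μ : Measure α) (R : α → Mat d) : Prop where
  sm : StronglyMeasurable R
  psd : ∀ a, (R a).PosSemidef
  int : Integrable (fun a => rtr (R a)) μ
  ent : Integrable (fun a => rtr (R a) * Real.log (rtr (R a))) μ

/-- Entropy of a matrix density. -/
def Hent {d : ℕ} {α : Type*} [MeasurableSpace α] (μ : Measure α) (R : α → Mat d) : ℝ :=
  ∫ a, vnEnt (R a) ∂μ

section FEsec
variable {d : ℕ} {α : Type*} [MeasurableSpace α] {μ : Measure α} {R : α → Mat d}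

lemma FE.integrable (h : FE μ R) : Integrable R μ := integrable_of_rtr h.sm h.psd h.int

lemma FE.vn (h : FE μ R) : Integrable (fun a => vnEnt (R a)) μ := by
  refine ((h.ent.abs).add (h.int.const_mul (d : ℝ))).mono'
    (sm_vn h.sm (fun a => (h.psd a).1)).aestronglyMeasurable (Eventually.of_forall fun a => ?_)
  have := vn_bounds (h.psd a)
  have ht := rtr_nonneg (h.psd a)
  have hd : 0 ≤ (d : ℝ) * rtr (R a) := by positivity
  have h1 := le_abs_self (rtr (R a) * Real.log (rtr (R a)))
  have h2 := neg_abs_le (rtr (R a) * Real.log (rtr (R a)))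
  simp only [Pi.add_apply, Real.norm_eq_abs]
  rw [abs_le]
  constructor <;> linarith

lemma FE.congr (h : FE μ R) {R' : α → Mat d} (hs : StronglyMeasurable R')
    (hp : ∀ a, (R' a).PosSemidef) (he : R =ᵐ[μ] R') : FE μ R' where
  sm := hs
  psd := hp
  int := h.int.congr (he.mono fun a ha => by simp only [ha])
  ent := h.ent.congr (he.mono fun a ha => by simp only [ha])

lemma Hent_congr {R' : α → Mat d} (he : R =ᵐ[μ] R') : Hent μ R = Hent μ R' :=
  integral_congr_ae (he.mono fun a ha => by simp only [ha])

lemma FE.comp {α' : Type*} [MeasurableSpace α'] {μ' : Measure α'} (h : FE μ R) {f : α' → α}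
    (hf : MeasurePreserving f μ' μ) : FE μ' (fun a => R (f a)) where
  sm := h.sm.comp_measurable hf.measurable
  psd := fun a => h.psd _
  int := (hf.integrable_comp h.int.1).2 h.int
  ent := (hf.integrable_comp h.ent.1).2 h.ent

lemma Hent_comp {α' : Type*} [MeasurableSpace α'] {μ' : Measure α'} (h : FE μ R) {f : α' → α}
    (hf : MeasurePreserving f μ' μ) : Hent μ' (fun a => R (f a)) = Hent μ R := by
  rw [Hent, Hent, ← hf.map_eq, integral_map hf.measurable.aemeasurable]
  rw [hf.map_eq]; exact h.vn.1

end FEsec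

lemma abs_rtr_mul_cfc_le {d : ℕ} {A B : Mat d} (hA : A.PosSemidef) (hB : B.IsHermitian)
    (f : ℝ → ℝ) : |rtr (A * cfc f B)| ≤ rtr (A * cfc (fun x => |f x|) B) := by
  rw [rtr_mul_cfc hA.1 hB, rtr_mul_cfc hA.1 hB]
  refine (Finset.abs_sum_le_sum_abs _ _).trans (Finset.sum_le_sum fun j _ => ?_)
  refine (Finset.abs_sum_le_sum_abs _ _).trans (Finset.sum_le_sum fun i _ => ?_)
  rw [abs_mul, abs_of_nonneg]
  exact mul_nonneg (by positivity) (hA.eigenvalues_nonneg i)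

lemma posDef_add_smul {d : ℕ} {Q : Mat d} (hQ : Q.PosSemidef) {δ : ℝ} (hδ : 0 < δ) :
    (Q + δ • (1 : Mat d)).PosDef := by
  refine Matrix.PosDef.posSemidef_add hQ ?_
  exact Matrix.PosDef.one.smul hδ

lemma cfc_shift {d : ℕ} {Q : Mat d} (hQ : Q.IsHermitian) (δ : ℝ) (g : ℝ → ℝ) :
    cfc g (Q + δ • (1 : Mat d)) = cfc (fun x => g (x + δ)) Q := by
  have hsa : IsSelfAdjoint Q := hQ
  have e : Q + δ • (1 : Mat d) = cfc (fun x => x + δ) Q := by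
    rw [cfc_add_const δ (fun x => x) Q, cfc_id' ℝ Q, Algebra.algebraMap_eq_smul_one]
  have hfin : (spectrum ℝ Q).Finite := by
    rw [hQ.spectrum_real_eq_range_eigenvalues]; exact Set.finite_range _
  rw [e, ← cfc_comp' g (fun x => x + δ) Q ((hfin.image _).continuousOn _)]

lemma rtr_mul_cfc_self {d : ℕ} {Q : Mat d} (hQ : Q.IsHermitian) (g : ℝ → ℝ) :
    rtr (Q * cfc g Q) = ∑ i, hQ.eigenvalues i * g (hQ.eigenvalues i) := by
  have hsa : IsSelfAdjoint Q := hQ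
  have hfin : (spectrum ℝ Q).Finite := by
    rw [hQ.spectrum_real_eq_range_eigenvalues]; exact Set.finite_range _
  have : Q * cfc g Q = cfc (fun x => x * g x) Q := by
    rw [cfc_mul (fun x => x) g Q continuousOn_id (hfin.continuousOn _), cfc_id' ℝ Q]
  rw [this, rtr_cfc hQ]

lemma mul_log_shift {x δ : ℝ} (hx : 0 ≤ x) (hδ : 0 < δ) :
    x * Real.log x ≤ x * Real.log (x + δ) ∧ x * Real.log (x + δ) ≤ x * Real.log x + δ := by
  rcases hx.eq_or_lt with h0 | h0
  · rw [← h0]; simp [hδ.le]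
  · constructor
    · exact mul_le_mul_of_nonneg_left (Real.log_le_log h0 (by linarith)) hx
    · have hh : Real.log ((x + δ) / x) ≤ (x + δ) / x - 1 := Real.log_le_sub_one_of_pos (by positivity)
      rw [Real.log_div (by positivity) (by positivity)] at hh
      have := mul_le_mul_of_nonneg_left hh hx
      have e : x * ((x + δ) / x - 1) = δ := by field_simp; ring
      linarith

lemma self_log_bounds {d : ℕ} {Q : Mat d} (hQ : Q.PosSemidef) {δ : ℝ} (hδ : 0 < δ) :
    -vnEnt Q ≤ rtr (Q * cfc Real.log (Q + δ • (1 : Mat d))) ∧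
    rtr (Q * cfc Real.log (Q + δ • (1 : Mat d))) ≤ -vnEnt Q + d * δ ∧
    rtr (Q * cfc (fun x => |Real.log x|) (Q + δ • (1 : Mat d))) ≤
      |rtr Q * Real.log (rtr Q)| + d * rtr Q + d * δ := by
  rw [cfc_shift hQ.1, cfc_shift hQ.1, rtr_mul_cfc_self hQ.1, rtr_mul_cfc_self hQ.1, vnEnt_eq hQ.1,
    ← Finset.sum_neg_distrib]
  have hs : ∀ c : ℝ, (d : ℝ) * c = ∑ _i : Fin d, c := by intro c; simp
  refine ⟨?_, ?_, ?_⟩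
  · refine Finset.sum_le_sum fun i _ => ?_
    have := (mul_log_shift (hQ.eigenvalues_nonneg i) hδ).1
    rw [negMulLog]; linarith
  · rw [hs, ← Finset.sum_add_distrib]
    refine Finset.sum_le_sum fun i _ => ?_
    have := (mul_log_shift (hQ.eigenvalues_nonneg i) hδ).2
    rw [negMulLog]; linarith
  · have e : |rtr Q * Real.log (rtr Q)| = ∑ i, hQ.1.eigenvalues i * |Real.log (rtr Q)| := by
      rw [abs_mul, abs_of_nonneg (rtr_nonneg hQ), ← Finset.sum_mul, ← rtr_eq_sum hQ.1]
    rw [e, hs, hs, ← Finset.sum_add_distrib, ← Finset.sum_add_distrib]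
    refine Finset.sum_le_sum fun i _ => ?_
    have ha := hQ.eigenvalues_nonneg i
    have hl := eig_le hQ i
    have h1 := mul_log_shift ha hδ
    set x := hQ.1.eigenvalues i
    set t := rtr Q
    have h2 : x * |Real.log (x + δ)| = |x * Real.log (x + δ)| := by
      rw [abs_mul, abs_of_nonneg ha]
    rw [h2]
    rcases ha.eq_or_lt with h0 | h0
    · rw [← h0]; simp; exact add_nonneg (rtr_nonneg hQ) hδ.le
    have ht : 0 < t := lt_of_lt_of_le h0 hl
    have hx : Real.log (t / x) ≤ t / x - 1 := Real.log_le_sub_one_of_pos (by positivity)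
    rw [Real.log_div (by positivity) (by positivity)] at hx
    have h3 := mul_le_mul_of_nonneg_left hx ha
    have e : x * (t / x - 1) = t - x := by field_simp
    rw [e] at h3
    have h4 := mul_le_mul_of_nonneg_left (Real.log_le_log h0 hl) ha
    have h5 := mul_le_mul_of_nonneg_left (le_abs_self (Real.log t)) ha
    have h6 := mul_le_mul_of_nonneg_left (neg_abs_le (Real.log t)) ha
    rw [abs_le]
    constructor <;> nlinarith

/-- Conditional-expectation lemma. -/
lemma ce_lemma {d : ℕ} {α ζ : Type*} [MeasurableSpace α] [MeasurableSpace ζ] {μ : Measure α}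
    {κ : Measure ζ} [SFinite μ] [SFinite κ] {T : α × ζ → Mat d} {Q : α → Mat d}
    (hT : StronglyMeasurable T) (hTp : ∀ x, (T x).PosSemidef)
    (hTi : Integrable (fun x => rtr (T x)) (μ.prod κ)) (hQ : FE μ Q)
    (hQT : ∀ᵐ a ∂μ, ∫ z, T (a, z) ∂κ = Q a) {δ : α → ℝ} (hδm : Measurable δ)
    (hδ : ∀ a, 0 < δ a) (hδi : Integrable δ μ) :
    Integrable (fun x : α × ζ => rtr (T x * cfc Real.log (Q x.1 + δ x.1 • (1 : Mat d)))) (μ.prod κ)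
    ∧ -Hent μ Q ≤ ∫ x, rtr (T x * cfc Real.log (Q x.1 + δ x.1 • (1 : Mat d))) ∂(μ.prod κ)
    ∧ ∫ x, rtr (T x * cfc Real.log (Q x.1 + δ x.1 • (1 : Mat d))) ∂(μ.prod κ) ≤
      -Hent μ Q + d * ∫ a, δ a ∂μ := by
  have hTI : Integrable T (μ.prod κ) := integrable_of_rtr hT hTp hTi
  have hB : ∀ a, (Q a + δ a • (1 : Mat d)).PosDef := fun a => posDef_add_smul (hQ.psd a) (hδ a)
  have hBm : StronglyMeasurable (fun a => Q a + δ a • (1 : Mat d)) :=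
    hQ.sm.add (hδm.stronglyMeasurable.smul stronglyMeasurable_const)
  have hLm := sm_cfc_log hBm (fun a => (hB a).1)
  have hfm : StronglyMeasurable
      (fun x : α × ζ => rtr (T x * cfc Real.log (Q x.1 + δ x.1 • (1 : Mat d)))) :=
    sm_rtr_mul hT (hLm.comp_measurable measurable_fst)
  have hsec := hTI.prod_right_ae
  have hval : ∀ᵐ a ∂μ, ∀ K : Mat d, ∫ z, rtr (T (a, z) * K) ∂κ = rtr (Q a * K) := by
    filter_upwards [hsec, hQT] with a ha hqa K
    rw [← hqa]
    exact (rtrMulL K).integral_comp_comm ha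
  have hIntg : Integrable
      (fun x : α × ζ => rtr (T x * cfc Real.log (Q x.1 + δ x.1 • (1 : Mat d)))) (μ.prod κ) := by
    rw [integrable_prod_iff hfm.aestronglyMeasurable]
    constructor
    · filter_upwards [hsec] with a ha
      exact (rtrMulL _).integrable_comp ha
    · refine (((hQ.ent.abs).add (hQ.int.const_mul (d : ℝ))).add (hδi.const_mul (d : ℝ))).mono'
        (hfm.norm.integral_prod_right).aestronglyMeasurable ?_
      filter_upwards [hsec, hval] with a ha hv
      rw [Real.norm_eq_abs, abs_of_nonneg (integral_nonneg fun z => norm_nonneg _)]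
      refine le_trans ?_ (self_log_bounds (hQ.psd a) (hδ a)).2.2
      rw [← hv]
      refine integral_mono ((rtrMulL _).integrable_comp ha).norm ((rtrMulL _).integrable_comp ha)
        (fun z => ?_)
      exact abs_rtr_mul_cfc_le (hTp _) (hB a).1 _
  have heq : ∫ x, rtr (T x * cfc Real.log (Q x.1 + δ x.1 • (1 : Mat d))) ∂(μ.prod κ) =
      ∫ a, rtr (Q a * cfc Real.log (Q a + δ a • (1 : Mat d))) ∂μ := by
    rw [integral_prod _ hIntg]
    refine integral_congr_ae ?_
    filter_upwards [hval] with a ha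
    exact ha _
  have hint2 : Integrable (fun a => rtr (Q a * cfc Real.log (Q a + δ a • (1 : Mat d)))) μ := by
    refine hIntg.integral_prod_left.congr ?_
    filter_upwards [hval] with a ha
    exact ha _
  refine ⟨hIntg, ?_, ?_⟩
  · rw [heq, Hent, ← integral_neg]
    exact integral_mono hQ.vn.neg hint2 fun a => (self_log_bounds (hQ.psd a) (hδ a)).1
  · rw [heq, Hent, ← integral_neg, ← integral_const_mul,
      ← integral_add (f := fun a => -vnEnt (Q a)) hQ.vn.neg (hδi.const_mul _)]
    exact integral_mono hint2 (hQ.vn.neg.add (hδi.const_mul _))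
      fun a => (self_log_bounds (hQ.psd a) (hδ a)).2.1

lemma exists_pos_integrable {α : Type*} [MeasurableSpace α] (μ : Measure α) [SigmaFinite μ] :
    ∃ g : α → ℝ, Measurable g ∧ (∀ a, 0 < g a) ∧ Integrable g μ := by
  obtain ⟨g, hg, hm, hi⟩ := exists_pos_lintegral_lt_of_sigmaFinite μ (ε := 1) one_ne_zero
  refine ⟨fun a => (g a : ℝ), hm.coe_nnreal_real, fun a => by exact_mod_cast hg a, ?_⟩
  refine ⟨hm.coe_nnreal_real.aestronglyMeasurable, ?_⟩
  rw [hasFiniteIntegral_iff_enorm]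
  refine lt_of_le_of_lt (le_of_eq ?_) (hi.trans ENNReal.one_lt_top)
  refine lintegral_congr fun a => ?_
  simp [enorm]

end partD

section partE

/-- Strong subadditivity. -/
lemma ssa {d : ℕ} {α β ζ : Type*} [MeasurableSpace α] [MeasurableSpace β] [MeasurableSpace ζ]
    {μ : Measure α} {ν : Measure β} {κ : Measure ζ} [SigmaFinite μ] [SigmaFinite ν]
    [SigmaFinite κ] (hν : ν ≠ 0) {T : α × β × ζ → Mat d} {Tab : α × β → Mat d} {Taz : α × ζ → Mat d}
    {Ta : α → Mat d} (hT : FE (μ.prod (ν.prod κ)) T) (hTab : FE (μ.prod ν) Tab)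
    (hTaz : FE (μ.prod κ) Taz) (hTa : FE μ Ta)
    (eab : ∀ᵐ x ∂(μ.prod ν), ∫ z, T (x.1, x.2, z) ∂κ = Tab x)
    (eaz : ∀ᵐ x ∂(μ.prod κ), ∫ b, T (x.1, b, x.2) ∂ν = Taz x)
    (ea : ∀ᵐ a ∂μ, ∫ b, Tab (a, b) ∂ν = Ta a) :
    Hent (μ.prod (ν.prod κ)) T + Hent μ Ta ≤ Hent (μ.prod ν) Tab + Hent (μ.prod κ) Taz := by
  obtain ⟨g0, g0m, g0p, g0i⟩ := exists_pos_integrable ν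
  obtain ⟨k0, k0m, k0p, k0i⟩ := exists_pos_integrable μ
  set G0 := ∫ b, g0 b ∂ν with hG0
  set K0 := ∫ a, k0 a ∂μ with hK0
  have hG0p : 0 < G0 := by
    rw [hG0, integral_pos_iff_support_of_nonneg (fun b => (g0p b).le) g0i]
    have : Function.support g0 = Set.univ := by
      ext b; simp [(g0p b).ne']
    rw [this]
    exact (Measure.measure_univ_pos).2 hν
  -- the equivalences
  have mp1 : MeasurePreserving (fun x : (α × β) × ζ => ((x.1.1, x.1.2, x.2) : α × β × ζ))
      ((μ.prod ν).prod κ) (μ.prod (ν.prod κ)) := measurePreserving_prodAssoc μ ν κ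
  have mp2 : MeasurePreserving (fun x : (α × ζ) × β => ((x.1.1, x.2, x.1.2) : α × β × ζ))
      ((μ.prod κ).prod ν) (μ.prod (ν.prod κ)) := by
    have h1 := measurePreserving_prodAssoc μ κ ν
    have h2 : MeasurePreserving (Prod.map id Prod.swap : α × ζ × β → α × β × ζ)
        (μ.prod (κ.prod ν)) (μ.prod (ν.prod κ)) :=
      (MeasurePreserving.id μ).prod Measure.measurePreserving_swap
    exact h2.comp h1
  have hT1 := hT.comp mp1
  have hT2 := hT.comp mp2
  -- a.e. statement for the marginal of Taz
  have eaz' : ∀ᵐ a ∂μ, ∫ z, Taz (a, z) ∂κ = Ta a := by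
    have s1 : ∀ᵐ a ∂μ, ∀ᵐ z ∂κ, ∫ b, T (a, b, z) ∂ν = Taz (a, z) := Measure.ae_ae_of_ae_prod eaz
    have s2 : ∀ᵐ a ∂μ, ∀ᵐ b ∂ν, ∫ z, T (a, b, z) ∂κ = Tab (a, b) := Measure.ae_ae_of_ae_prod eab
    filter_upwards [s1, s2, ea, hT.integrable.prod_right_ae] with a h1 h2 h3 h4
    rw [← h3]
    calc ∫ z, Taz (a, z) ∂κ = ∫ z, ∫ b, T (a, b, z) ∂ν ∂κ :=
          integral_congr_ae (h1.mono fun z hz => hz.symm)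
      _ = ∫ b, ∫ z, T (a, b, z) ∂κ ∂ν := (integral_integral_swap (f := fun b z => T (a, b, z)) h4).symm
      _ = _ := integral_congr_ae h2
  have main : ∀ ε : ℝ, 0 < ε → Hent (μ.prod (ν.prod κ)) T + Hent μ Ta ≤
      Hent (μ.prod ν) Tab + Hent (μ.prod κ) Taz + ε * (d * (K0 * G0)) := by
    intro ε hε
    set δ1 : α × β → ℝ := fun x => ε * (k0 x.1 * g0 x.2) with hδ1
    set δ2 : α → ℝ := fun a => ε * (k0 a * G0) with hδ2
    have hδ1p : ∀ x, 0 < δ1 x := fun x => mul_pos hε (mul_pos (k0p _) (g0p _))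
    have hδ2p : ∀ x, 0 < δ2 x := fun x => mul_pos hε (mul_pos (k0p _) hG0p)
    have hδ1i : Integrable δ1 (μ.prod ν) := (k0i.mul_prod g0i).const_mul ε
    have hδ2i : Integrable δ2 μ := (k0i.mul_const G0).const_mul ε
    have hδ1m : Measurable δ1 := by fun_prop
    have hδ2m : Measurable δ2 := by fun_prop
    obtain ⟨c1, c2, -⟩ := ce_lemma hT1.sm hT1.psd hT1.int hTab eab hδ1m hδ1p hδ1i
    obtain ⟨c3, -, c4⟩ := ce_lemma hTaz.sm hTaz.psd hTaz.int hTa eaz' hδ2m hδ2p hδ2i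
    set B : α × β → Mat d := fun x => Tab x + δ1 x • (1 : Mat d) with hB
    have hBp : ∀ x, (B x).PosDef := fun x => posDef_add_smul (hTab.psd x) (hδ1p x)
    set C : α → Mat d := fun a => Ta a + δ2 a • (1 : Mat d) with hC
    have hCp : ∀ x, (C x).PosDef := fun x => posDef_add_smul (hTa.psd x) (hδ2p x)
    have hBm : StronglyMeasurable B :=
      hTab.sm.add (hδ1m.stronglyMeasurable.smul stronglyMeasurable_const)
    have hBi : Integrable B (μ.prod ν) := hTab.integrable.add (hδ1i.smul_const _)
    have hBC : ∀ᵐ a ∂μ, Integrable (fun b => B (a, b)) ν ∧ ∫ b, B (a, b) ∂ν = C a := by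
      filter_upwards [hTab.integrable.prod_right_ae, hδ1i.prod_right_ae, ea] with a h1 h2 h3
      refine ⟨h1.add (h2.smul_const _), ?_⟩
      simp only [hB, hC]
      rw [integral_add h1 (h2.smul_const _), h3, integral_smul_const]
      congr 2
      simp only [hδ1, hδ2, integral_const_mul]
      rw [hG0]
    -- relative entropy integrable on the triple product
    set F : α × β × ζ → ℝ := fun x => rtr (T x * cfc Real.log (B (x.1, x.2.1))) with hF
    have hFm : StronglyMeasurable F :=
      sm_rtr_mul hT.sm ((sm_cfc_log hBm (fun x => (hBp x).1)).comp_measurable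
        (measurable_fst.prodMk (measurable_fst.comp measurable_snd)))
    have hFi : Integrable F (μ.prod (ν.prod κ)) :=
      (mp1.integrable_comp hFm.aestronglyMeasurable).1 c1
    have hFint : ∫ x, F x ∂(μ.prod (ν.prod κ)) =
        ∫ x : (α × β) × ζ, rtr (T (x.1.1, x.1.2, x.2) * cfc Real.log (Tab x.1 + δ1 x.1 • (1 : Mat d)))
          ∂((μ.prod ν).prod κ) := by
      rw [← mp1.map_eq, integral_map mp1.measurable.aemeasurable hFm.aestronglyMeasurable]
    set D : α × β × ζ → ℝ := fun x => qD (T x) (B (x.1, x.2.1)) with hD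
    have hDi : Integrable D (μ.prod (ν.prod κ)) := hT.vn.neg.sub hFi
    have hDint : ∫ x, D x ∂(μ.prod (ν.prod κ)) = -Hent (μ.prod (ν.prod κ)) T
        - ∫ x, F x ∂(μ.prod (ν.prod κ)) := by
      simp only [hD, qD]
      rw [integral_sub (f := fun x => -vnEnt (T x)) hT.vn.neg hFi, integral_neg]; rfl
    have hD2i : Integrable (fun x : (α × ζ) × β => D (x.1.1, x.2, x.1.2)) ((μ.prod κ).prod ν) :=
      (mp2.integrable_comp hDi.1).2 hDi
    have hD2int : ∫ x, D x ∂(μ.prod (ν.prod κ)) =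
        ∫ y : α × ζ, ∫ b, D (y.1, b, y.2) ∂ν ∂(μ.prod κ) := by
      rw [← integral_prod _ hD2i, ← mp2.map_eq,
        integral_map mp2.measurable.aemeasurable (by rw [mp2.map_eq]; exact hDi.1)]
    have hle : ∀ᵐ y ∂(μ.prod κ), qD (Taz y) (C y.1) ≤ ∫ b, D (y.1, b, y.2) ∂ν := by
      have hBC' : ∀ᵐ y ∂(μ.prod κ), Integrable (fun b => B (y.1, b)) ν ∧ ∫ b, B (y.1, b) ∂ν = C y.1 :=
        Measure.quasiMeasurePreserving_fst.ae hBC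
      filter_upwards [hBC', eaz, hD2i.prod_right_ae, hT2.integrable.prod_right_ae] with y h1 h2 h3 h4
      rw [← h1.2, ← h2]
      refine subadd (fun b => hT.psd _) (fun b => hBp _) h4 h1.1 h3 (psd_integral fun b => hT.psd _) ?_
      rw [h1.2]; exact hCp _
    have hqi : Integrable (fun y : α × ζ => qD (Taz y) (C y.1)) (μ.prod κ) := hTaz.vn.neg.sub c3
    have hqint : ∫ y, qD (Taz y) (C y.1) ∂(μ.prod κ) = -Hent (μ.prod κ) Taz
        - ∫ y, rtr (Taz y * cfc Real.log (C y.1)) ∂(μ.prod κ) := by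
      simp only [qD]
      rw [integral_sub (f := fun x => -vnEnt (Taz x)) hTaz.vn.neg c3, integral_neg]; rfl
    have := integral_mono_ae hqi hD2i.integral_prod_left hle
    rw [hqint, ← hD2int, hDint, hFint] at this
    have e2 : ∫ a, δ2 a ∂μ = ε * (K0 * G0) := by
      simp only [hδ2, integral_const_mul, integral_mul_const]
      rw [hK0]
    rw [e2] at c4
    linarith
  refine le_of_forall_pos_le_add fun η hη => ?_
  have hb : 0 ≤ (d : ℝ) * (K0 * G0) := by
    have : 0 ≤ K0 := integral_nonneg fun a => (k0p a).le
    positivity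
  have := main (η / (d * (K0 * G0) + 1)) (by positivity)
  refine this.trans ?_
  gcongr
  rw [div_mul_eq_mul_div, div_le_iff₀ (by positivity)]
  nlinarith

end partE

section partF

/-! ### smoothing -/

section Smooth
variable {V : Type*} [NormedAddCommGroup V] [NormedSpace ℝ V] [FiniteDimensional ℝ V]
  [MeasurableSpace V] [BorelSpace V] {m : Measure V} [m.IsAddHaarMeasure] {d : ℕ}

lemma mp_shift {ζ : Type*} [MeasurableSpace ζ] {ν : Measure ζ} [SFinite ν] {f : ζ → V}
    (hf : Measurable f) :
    MeasurePreserving (fun x : V × ζ => (x.1 - f x.2, x.2)) (m.prod ν) (m.prod ν) := by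
  have h1 : MeasurePreserving (fun x : ζ × V => (x.1, x.2 - f x.1)) (ν.prod m) (ν.prod m) := by
    refine MeasurePreserving.skew_product (f := id) (g := fun z a => a - f z)
      (MeasurePreserving.id ν) (by fun_prop) (Eventually.of_forall fun z => ?_)
    exact (measurePreserving_sub_right m (f z)).map_eq
  have h2 : MeasurePreserving (Prod.swap : V × ζ → ζ × V) (m.prod ν) (ν.prod m) :=
    Measure.measurePreserving_swap
  have h3 : MeasurePreserving (Prod.swap : ζ × V → V × ζ) (ν.prod m) (m.prod ν) :=
    Measure.measurePreserving_swap
  exact h3.comp (h1.comp h2)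

lemma mp_shift_fst {ζ : Type*} [MeasurableSpace ζ] {ν : Measure ζ} [IsProbabilityMeasure ν]
    {f : ζ → V} (hf : Measurable f) :
    MeasurePreserving (fun x : V × ζ => x.1 - f x.2) (m.prod ν) m :=
  measurePreserving_fst.comp (mp_shift (m := m) (ν := ν) hf)

/-- smoothing of a function by a measure -/
def smooth (ν : Measure V) (R : V → Mat d) : V → Mat d := fun a => ∫ z, R (a - z) ∂ν

/-- finite entropy and finite second moment -/
structure FE2 {V : Type*} [NormedAddCommGroup V] [MeasurableSpace V] (m : Measure V)
    (R : V → Mat d) : Prop extends FE m R where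
  mom : Integrable (fun a => ‖a‖ ^ 2 * rtr (R a)) m

lemma rtr_integral {α : Type*} [MeasurableSpace α] {μ : Measure α} {R : α → Mat d}
    (hR : StronglyMeasurable R) (hp : ∀ a, (R a).PosSemidef) :
    rtr (∫ a, R a ∂μ) = ∫ a, rtr (R a) ∂μ := by
  by_cases h : Integrable R μ
  · simpa using ((rtrL (d := d)).integral_comp_comm h).symm
  · have : ¬ Integrable (fun a => rtr (R a)) μ := fun h' => h (integrable_of_rtr hR hp h')
    rw [integral_undef h, integral_undef this, rtr_zero]

lemma sm_smooth {ν : Measure V} [SFinite ν] {R : V → Mat d} (hR : StronglyMeasurable R) :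
    StronglyMeasurable (smooth ν R) := by
  have : StronglyMeasurable (fun x : V × V => R (x.1 - x.2)) := hR.comp_measurable (by fun_prop)
  exact this.integral_prod_right

lemma psd_smooth {ν : Measure V} {R : V → Mat d} (hR : ∀ a, (R a).PosSemidef) (a : V) :
    (smooth ν R a).PosSemidef := psd_integral fun _ => hR _

lemma mul_log_ge {p q : ℝ} (hp : 0 ≤ p) (hq : 0 < q) : p * Real.log q + p - q ≤ p * Real.log p := by
  rcases hp.eq_or_lt with h0 | h0
  · rw [← h0]; simp [hq.le]
  · have hh : Real.log (q / p) ≤ q / p - 1 := Real.log_le_sub_one_of_pos (by positivity)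
    rw [Real.log_div (by positivity) (by positivity)] at hh
    have := mul_le_mul_of_nonneg_left hh hp
    have e : p * (q / p - 1) = q - p := by field_simp
    linarith

/-- Lower bound making `t log t` integrable from second moments. -/
lemma ent_of_upper {t h : V → ℝ} (tm : AEStronglyMeasurable t m) (t0 : ∀ a, 0 ≤ t a)
    (ti : Integrable t m) (tmom : Integrable (fun a => ‖a‖ ^ 2 * t a) m) (hi : Integrable h m)
    (hle : ∀ᵐ a ∂m, t a * Real.log (t a) ≤ h a) :
    Integrable (fun a => t a * Real.log (t a)) m := by
  set r : ℝ := (Module.finrank ℝ V : ℝ) + 1 with hr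
  have hr0 : 0 ≤ r := by positivity
  have hq : Integrable (fun a : V => (1 + ‖a‖) ^ (-r)) m :=
    integrable_one_add_norm (by rw [hr]; linarith)
  have hlow : ∀ a, -(r * (t a + ‖a‖ ^ 2 * t a)) - (1 + ‖a‖) ^ (-r) ≤ t a * Real.log (t a) := by
    intro a
    have hpos : 0 < 1 + ‖a‖ := by positivity
    have := mul_log_ge (t0 a) (Real.rpow_pos_of_pos hpos (-r))
    rw [Real.log_rpow hpos] at this
    have h1 : Real.log (1 + ‖a‖) ≤ 1 + ‖a‖ ^ 2 := by
      have := Real.log_le_sub_one_of_pos hpos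
      nlinarith [sq_nonneg (‖a‖ - 1), norm_nonneg a]
    have h2 : t a * (r * Real.log (1 + ‖a‖)) ≤ t a * (r * (1 + ‖a‖ ^ 2)) :=
      mul_le_mul_of_nonneg_left (mul_le_mul_of_nonneg_left h1 hr0) (t0 a)
    have := t0 a
    nlinarith
  refine (hi.abs.add (((ti.add tmom).const_mul r).add hq)).mono'
    (tm.mul ((Real.measurable_log.comp_aemeasurable tm.aemeasurable).aestronglyMeasurable)) ?_
  filter_upwards [hle] with a ha
  have h1 := hlow a
  have h2 := le_abs_self (h a)
  have h3 : 0 ≤ r * (t a + ‖a‖ ^ 2 * t a) := by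
    have := t0 a
    positivity
  have h4 : 0 ≤ (1 + ‖a‖) ^ (-r) := by positivity
  simp only [Pi.add_apply, Real.norm_eq_abs]
  rw [abs_le]
  constructor
  · have := abs_nonneg (h a); linarith
  · linarith

lemma FE2.smooth {R : V → Mat d} (h : FE2 m R) {ν : Measure V} [IsProbabilityMeasure ν]
    (hν : Integrable (fun z => ‖z‖ ^ 2) ν) : FE2 m (smooth ν R) := by
  have mp := mp_shift (m := m) (ν := ν) measurable_id
  have mpf := mp_shift_fst (m := m) (ν := ν) measurable_id
  simp only [id] at mp mpf
  have hT := h.toFE.comp mpf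
  have hsm := sm_smooth (ν := ν) h.sm
  have hpsd := psd_smooth (ν := ν) h.psd
  have hr : ∀ a, rtr (_root_.smooth ν R a) = ∫ z, rtr (R (a - z)) ∂ν := fun a =>
    rtr_integral (h.sm.comp_measurable (by fun_prop)) (fun _ => h.psd _)
  have hIntg : Integrable (fun a => rtr (_root_.smooth ν R a)) m := by
    simp only [hr]; exact hT.int.integral_prod_left
  have hmomT : Integrable (fun x : V × V => ‖x.1‖ ^ 2 * rtr (R (x.1 - x.2))) (m.prod ν) := by
    have i1 : Integrable (fun x : V × V => ‖x.1 - x.2‖ ^ 2 * rtr (R (x.1 - x.2))) (m.prod ν) :=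
      (mpf.integrable_comp h.mom.1).2 h.mom
    have i2 : Integrable (fun x : V × V => rtr (R (x.1 - x.2)) * ‖x.2‖ ^ 2) (m.prod ν) :=
      (mp.integrable_comp (h.int.mul_prod hν).1).2 (h.int.mul_prod hν)
    refine ((i1.const_mul 2).add (i2.const_mul 2)).mono' ?_ (Eventually.of_forall fun x => ?_)
    · exact ((measurable_fst.norm.pow_const 2).aestronglyMeasurable).mul hT.int.1
    · have h0 := rtr_nonneg (h.psd (x.1 - x.2))
      simp only [Pi.add_apply]
      rw [Real.norm_eq_abs, abs_of_nonneg (by positivity)]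
      have h1 : ‖x.1‖ ≤ ‖x.1 - x.2‖ + ‖x.2‖ := by
        calc ‖x.1‖ = ‖(x.1 - x.2) + x.2‖ := by simp
          _ ≤ _ := norm_add_le _ _
      have h2 : ‖x.1‖ ^ 2 ≤ 2 * ‖x.1 - x.2‖ ^ 2 + 2 * ‖x.2‖ ^ 2 := by
        have := norm_nonneg x.1
        nlinarith [sq_nonneg (‖x.1 - x.2‖ - ‖x.2‖), norm_nonneg (x.1 - x.2), norm_nonneg x.2]
      nlinarith
  have hmom : Integrable (fun a => ‖a‖ ^ 2 * rtr (_root_.smooth ν R a)) m := by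
    simp only [hr, ← integral_const_mul]; exact hmomT.integral_prod_left
  refine ⟨⟨hsm, hpsd, hIntg, ?_⟩, hmom⟩
  refine ent_of_upper (h := fun a => ∫ z, rtr (R (a - z)) * Real.log (rtr (R (a - z))) ∂ν)
    hIntg.1 (fun a => rtr_nonneg (hpsd a)) hIntg hmom hT.ent.integral_prod_left ?_
  filter_upwards [hT.int.prod_right_ae, hT.ent.prod_right_ae] with a h1 h2
  rw [hr]
  exact Real.convexOn_mul_log.map_integral_le Real.continuous_mul_log.continuousOn isClosed_Ici
    (Eventually.of_forall fun z => rtr_nonneg (h.psd _)) h1 h2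

lemma smooth_congr {R R' : V → Mat d} {ν : Measure V} [IsProbabilityMeasure ν]
    (h : R =ᵐ[m] R') : smooth ν R =ᵐ[m] smooth ν R' := by
  have mpf := mp_shift_fst (m := m) (ν := ν) measurable_id
  have := mpf.quasiMeasurePreserving.ae h
  filter_upwards [Measure.ae_ae_of_ae_prod this] with a ha
  exact integral_congr_ae ha

lemma smooth_dirac (R : V → Mat d) : smooth (Measure.dirac 0) R = R := by
  ext1 a; simp [smooth]

lemma integral_smooth {R : V → Mat d} (h : FE m R) {ν : Measure V} [IsProbabilityMeasure ν] :
    ∫ a, smooth ν R a ∂m = ∫ a, R a ∂m := by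
  have mpf := mp_shift_fst (m := m) (ν := ν) measurable_id
  have hT := h.comp mpf
  simp only [smooth]
  have e := integral_prod _ hT.integrable
  simp only [id] at e
  rw [← e]
  have e2 := integral_map mpf.measurable.aemeasurable (f := R) (by rw [mpf.map_eq]; exact h.integrable.1)
  rw [mpf.map_eq] at e2
  simpa using e2.symm

lemma smooth_smooth {R : V → Mat d} (h : FE m R) {ν ν' : Measure V} [IsProbabilityMeasure ν]
    [IsProbabilityMeasure ν'] :
    smooth ν (smooth ν' R) =ᵐ[m] smooth ((ν.prod ν').map (fun x => x.1 + x.2)) R := by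
  have mpf := mp_shift_fst (m := m) (ν := ν.prod ν') (f := fun x : V × V => x.1 + x.2) (by fun_prop)
  have hT := h.comp mpf
  filter_upwards [hT.integrable.prod_right_ae] with a ha
  simp only [smooth]
  have e := integral_map (μ := ν.prod ν') (φ := fun x : V × V => x.1 + x.2)
    (f := fun z => R (a - z)) (by fun_prop)
    (h.sm.comp_measurable (by fun_prop : Measurable fun z => a - z)).aestronglyMeasurable
  rw [e, integral_prod _ ha]
  simp only [sub_sub]

/-- Concavity of the entropy under smoothing. -/
lemma concav {R : V → Mat d} (h : FE2 m R) {ν ν' : Measure V} [IsProbabilityMeasure ν]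
    [IsProbabilityMeasure ν'] (hν : Integrable (fun z => ‖z‖ ^ 2) ν)
    (hν' : Integrable (fun z => ‖z‖ ^ 2) ν') :
    Hent m R + Hent m (smooth ν (smooth ν' R)) ≤ Hent m (smooth ν R) + Hent m (smooth ν' R) := by
  have mp1 := mp_shift_fst (m := m) (ν := ν.prod ν') (f := fun x : V × V => x.1 + x.2) (by fun_prop)
  have mp2 := mp_shift_fst (m := m) (ν := ν) measurable_id
  have mp3 := mp_shift_fst (m := m) (ν := ν') measurable_id
  have hs := h.smooth hν
  have hs' := h.smooth hν'
  have key := ssa (μ := m) (ν := ν) (κ := ν') (IsProbabilityMeasure.ne_zero ν)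
    (h.toFE.comp mp1) (hs'.toFE.comp mp2) (hs.toFE.comp mp3) (hs'.smooth hν).toFE
    (Eventually.of_forall fun x => by simp only [smooth, id, sub_sub])
    (Eventually.of_forall fun x => by
      simp only [smooth, id, sub_sub]
      congr 1; ext1 b; rw [add_comm])
    (Eventually.of_forall fun x => rfl)
  rw [Hent_comp h.toFE mp1, Hent_comp hs'.toFE mp2, Hent_comp hs.toFE mp3] at key
  linarith

end Smooth

end partF

section partG

/-! ### coordinates on pairs -/

/-- product Lebesgue measure on pairs -/
abbrev mm (n : ℕ) : Measure (En n × En n) := (volume : Measure (En n)).prod volume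

instance mmHaar (n : ℕ) : (mm n).IsAddHaarMeasure := inferInstance

/-- linear coordinates on pairs -/
structure Coord {n : ℕ} (φ : En n × En n → En n × En n) (L P : En n × En n → En n) : Prop where
  mp : MeasurePreserving φ (mm n) (mm n)
  mL : Measurable L
  mP : Measurable P
  shift : ∀ s x z, φ (s, x) - z = φ (s - L z, x - P z)
  bd : ∀ z, ‖L z‖ ≤ 2 * ‖z‖

section CoordSec
variable {n d : ℕ}

lemma coordX : Coord (n := n) id Prod.fst Prod.snd where
  mp := MeasurePreserving.id _
  mL := measurable_fst
  mP := measurable_snd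
  shift := fun s x z => rfl
  bd := fun z => by have := norm_fst_le z; have := norm_nonneg z; linarith

lemma coordY : Coord (n := n) Prod.swap Prod.snd Prod.fst where
  mp := Measure.measurePreserving_swap
  mL := measurable_snd
  mP := measurable_fst
  shift := fun s x z => rfl
  bd := fun z => by have := norm_snd_le z; have := norm_nonneg z; linarith

lemma coordW : Coord (n := n) (fun x => (x.2, x.1 - x.2)) (fun z => z.1 + z.2) Prod.fst where
  mp := (Measure.measurePreserving_swap (μ := volume) (ν := volume)).comp
    (mp_shift (m := (volume : Measure (En n))) (ν := (volume : Measure (En n))) measurable_id)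
  mL := by fun_prop
  mP := measurable_fst
  shift := fun s x z => by ext1 <;> simp; abel
  bd := fun z => by
    have := norm_snd_le z; have := norm_fst_le z; have := norm_add_le z.1 z.2; linarith

/-- `X` is the marginal of `R` in coordinates `φ` -/
def IsMarg (φ : En n × En n → En n × En n) (R : En n × En n → Mat d) (X : En n → Mat d) : Prop :=
  ∀ᵐ s, ∫ x, R (φ (s, x)) = X s

variable {φ : En n × En n → En n × En n} {L P : En n × En n → En n}
  {R : En n × En n → Mat d} {X : En n → Mat d} {ν : Measure (En n × En n)}
  [IsProbabilityMeasure ν]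

lemma Coord.mpT (c : Coord φ L P) : MeasurePreserving
    (fun y : En n × En n × (En n × En n) => φ (y.1, y.2.1) - y.2.2)
    ((volume : Measure (En n)).prod ((volume : Measure (En n)).prod ν)) (mm n) := by
  have h1 : MeasurePreserving (fun x : (En n × En n) × (En n × En n) => (φ x.1, x.2))
      ((mm n).prod ν) ((mm n).prod ν) := c.mp.prod (MeasurePreserving.id ν)
  have h2 := mp_shift_fst (m := mm n) (ν := ν) measurable_id
  have h3 := (measurePreserving_prodAssoc (volume : Measure (En n)) (volume : Measure (En n)) ν).symm
  exact h2.comp (h1.comp h3)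

lemma Coord.eaz (c : Coord φ L P) (hm : IsMarg φ R X) :
    ∀ᵐ y ∂((volume : Measure (En n)).prod ν),
      ∫ x, R (φ (y.1, x) - y.2) = X (y.1 - L y.2) := by
  have mpf := mp_shift_fst (m := (volume : Measure (En n))) (ν := ν) c.mL
  filter_upwards [mpf.quasiMeasurePreserving.ae hm] with y hy
  rw [← hy]
  simp only [c.shift]
  exact integral_sub_right_eq_self (fun x => R (φ (y.1 - L y.2, x))) (P y.2)

lemma Coord.mapL (c : Coord φ L P) (hX : FE volume X) (s : En n) :
    smooth (ν.map L) X s = ∫ z, X (s - L z) ∂ν :=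
  integral_map (f := fun z => X (s - z)) c.mL.aemeasurable
    (hX.sm.comp_measurable (by fun_prop : Measurable fun z => s - z)).aestronglyMeasurable

lemma Coord.momL (c : Coord φ L P) (hν : Integrable (fun z => ‖z‖ ^ 2) ν) :
    Integrable (fun z => ‖z‖ ^ 2) (ν.map L) := by
  rw [integrable_map_measure (by fun_prop) c.mL.aemeasurable]
  refine (hν.const_mul 4).mono' (c.mL.norm.pow_const 2).aestronglyMeasurable
    (Eventually.of_forall fun z => ?_)
  simp only [Function.comp]
  rw [Real.norm_eq_abs, abs_of_nonneg (by positivity)]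
  have := c.bd z
  nlinarith [norm_nonneg z, norm_nonneg (L z)]

lemma Coord.marg (c : Coord φ L P) (hR : FE (mm n) R) (hX : FE volume X) (hm : IsMarg φ R X) :
    IsMarg φ (smooth ν R) (smooth (ν.map L) X) := by
  have hT := hR.comp (c.mpT (ν := ν))
  filter_upwards [hT.integrable.prod_right_ae, Measure.ae_ae_of_ae_prod (c.eaz (ν := ν) hm)]
    with s h1 h2
  rw [c.mapL hX]
  simp only [smooth]
  rw [integral_integral_swap h1]
  exact integral_congr_ae h2

lemma Coord.star (c : Coord φ L P) (hR : FE2 (mm n) R) (hX : FE2 volume X) (hm : IsMarg φ R X)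
    (hν : Integrable (fun z => ‖z‖ ^ 2) ν) :
    Hent (mm n) R + Hent volume (smooth (ν.map L) X) ≤ Hent (mm n) (smooth ν R) + Hent volume X := by
  have mpf := mp_shift_fst (m := (volume : Measure (En n))) (ν := ν) c.mL
  have : IsProbabilityMeasure (ν.map L) := Measure.isProbabilityMeasure_map c.mL.aemeasurable
  have hs := hR.smooth hν
  have hsX := hX.smooth (c.momL hν)
  have key := ssa (μ := (volume : Measure (En n))) (ν := (volume : Measure (En n))) (κ := ν)
    (NeZero.ne _) (hR.toFE.comp (c.mpT (ν := ν))) (hs.toFE.comp c.mp) (hX.toFE.comp mpf) hsX.toFE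
    (Eventually.of_forall fun x => rfl) (c.eaz hm) (c.marg hR.toFE hX.toFE hm)
  rwa [Hent_comp hR.toFE c.mpT, Hent_comp hs.toFE c.mp, Hent_comp hX.toFE mpf] at key

end CoordSec

/-- subadditivity given the quantum system -/
lemma subadd2 {d : ℕ} {β ζ : Type*} [MeasurableSpace β] [MeasurableSpace ζ]
    {ν : Measure β} {κ : Measure ζ} [SigmaFinite ν]
    [SigmaFinite κ] (hν : ν ≠ 0) {K : β × ζ → Mat d} {Kb : β → Mat d} {Kz : ζ → Mat d}
    (hK : FE (ν.prod κ) K) (hKb : FE ν Kb) (hKz : FE κ Kz)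
    (eb : ∀ᵐ x ∂ν, ∫ z, K (x, z) ∂κ = Kb x) (ez : ∀ᵐ x ∂κ, ∫ b, K (b, x) ∂ν = Kz x) :
    Hent (ν.prod κ) K + vnEnt (∫ b, Kb b ∂ν) ≤ Hent ν Kb + Hent κ Kz := by
  have m1 : MeasurePreserving (Prod.snd : Unit × (β × ζ) → β × ζ)
    ((Measure.dirac ()).prod (ν.prod κ)) (ν.prod κ) := measurePreserving_snd
  have m2 : MeasurePreserving (Prod.snd : Unit × β → β)
    ((Measure.dirac ()).prod ν) ν := measurePreserving_snd
  have m3 : MeasurePreserving (Prod.snd : Unit × ζ → ζ)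
    ((Measure.dirac ()).prod κ) κ := measurePreserving_snd
  have h0 : FE (Measure.dirac ()) (fun _ : Unit => ∫ b, Kb b ∂ν) :=
    ⟨stronglyMeasurable_const, fun _ => psd_integral hKb.psd, by simp, by simp⟩
  have key := ssa (μ := Measure.dirac ()) hν (hK.comp m1) (hKb.comp m2) (hKz.comp m3) h0
    (m2.quasiMeasurePreserving.ae eb) (m3.quasiMeasurePreserving.ae ez)
    (Eventually.of_forall fun _ => rfl)
  rw [Hent_comp hK m1, Hent_comp hKb m2, Hent_comp hKz m3] at key
  simpa [Hent] using key

end partG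

section partH

/-! ### Gaussian family -/

section Gauss
variable {n : ℕ}

/-- centered Gaussian with variance `t` -/
def gs (n : ℕ) (t : ℝ) : Measure (En n) :=
  (ProbabilityTheory.stdGaussian (En n)).map (fun z => Real.sqrt t • z)

instance gsProb (t : ℝ) : IsProbabilityMeasure (gs n t) :=
  Measure.isProbabilityMeasure_map (by fun_prop)

lemma charFun_gs {t : ℝ} (ht : 0 ≤ t) (x : En n) :
    charFun (gs n t) x = Complex.exp ((-(t * ‖x‖ ^ 2 / 2) : ℝ)) := by
  have h := charFun_map_smul (μ := ProbabilityTheory.stdGaussian (En n)) (Real.sqrt t) x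
  rw [gs]
  erw [h]
  rw [ProbabilityTheory.charFun_stdGaussian, norm_smul, Real.norm_eq_abs,
    abs_of_nonneg (Real.sqrt_nonneg t)]
  congr 1
  rw [← Complex.ofReal_pow, mul_pow, Real.sq_sqrt ht]
  push_cast; ring

lemma gs_add {s t : ℝ} (hs : 0 ≤ s) (ht : 0 ≤ t) :
    ((gs n s).prod (gs n t)).map (fun x => x.1 + x.2) = gs n (s + t) := by
  have : IsProbabilityMeasure (((gs n s).prod (gs n t)).map (fun x => x.1 + x.2)) :=
    Measure.isProbabilityMeasure_map (by fun_prop)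
  apply Measure.ext_of_charFun
  rw [ProbabilityTheory.charFun_map_add_prod_eq_mul]
  ext x
  rw [Pi.mul_apply, charFun_gs hs, charFun_gs ht, charFun_gs (by positivity), ← Complex.exp_add]
  congr 1
  push_cast; ring

lemma gs_smul {t c : ℝ} (ht : 0 ≤ t) :
    (gs n t).map (fun z => c • z) = gs n (c ^ 2 * t) := by
  have : IsProbabilityMeasure ((gs n t).map (fun z => c • z)) :=
    Measure.isProbabilityMeasure_map (by fun_prop)
  apply Measure.ext_of_charFun
  ext x
  have h := charFun_map_smul (μ := gs n t) c x
  erw [h]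
  rw [charFun_gs ht, charFun_gs (by positivity), norm_smul, mul_pow, Real.norm_eq_abs, sq_abs]
  congr 2; ring

lemma gs_zero : gs n 0 = Measure.dirac 0 := by
  simp [gs, Measure.map_const]

lemma gs_mom1 : Integrable (fun z => ‖z‖ ^ 2) (ProbabilityTheory.stdGaussian (En n)) := by
  have := (ProbabilityTheory.IsGaussian.memLp_two_id
    (μ := ProbabilityTheory.stdGaussian (En n))).integrable_norm_pow (by norm_num)
  simpa using this

lemma gs_mom (t : ℝ) : Integrable (fun z => ‖z‖ ^ 2) (gs n t) := by
  rw [gs, integrable_map_measure (by fun_prop) (by fun_prop)]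
  have := (gs_mom1 (n := n)).const_mul (Real.sqrt t ^ 2)
  refine this.congr (Eventually.of_forall fun z => ?_)
  simp only [Function.comp, norm_smul, mul_pow, Real.norm_eq_abs, sq_abs]

/-- second moment of the standard Gaussian -/
def c2 (n : ℕ) : ℝ := ∫ z, ‖z‖ ^ 2 ∂(ProbabilityTheory.stdGaussian (En n))

lemma gs_mom_eq {t : ℝ} (ht : 0 ≤ t) : ∫ z, ‖z‖ ^ 2 ∂(gs n t) = t * c2 n := by
  rw [gs, integral_map (by fun_prop) (by fun_prop), c2, ← integral_const_mul]
  congr 1; ext z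
  rw [norm_smul, mul_pow, Real.norm_eq_abs, sq_abs, Real.sq_sqrt ht]

/-- Gaussian density -/
def gd (n : ℕ) (t : ℝ) (z : En n) : ℝ := (2 * π * t) ^ (-(n : ℝ) / 2) * Real.exp (-‖z‖ ^ 2 / (2 * t))

lemma gd_pos {t : ℝ} (ht : 0 < t) (z : En n) : 0 < gd n t z := by
  have := Real.pi_pos
  unfold gd; positivity

lemma gd_meas (t : ℝ) : Measurable (gd n t) := by unfold gd; fun_prop

lemma gd_log {t : ℝ} (ht : 0 < t) (z : En n) :
    Real.log (gd n t z) = -((n : ℝ) / 2 * Real.log (2 * π * t)) - ‖z‖ ^ 2 / (2 * t) := by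
  have := Real.pi_pos
  rw [gd, Real.log_mul (by positivity) (by positivity), Real.log_exp, Real.log_rpow (by positivity)]
  ring

lemma gd_integral {t : ℝ} (ht : 0 < t) : ∫ z, gd n t z = 1 := by
  have := Real.pi_pos
  have h := GaussianFourier.integral_rexp_neg_mul_sq_norm (V := En n) (b := 1 / (2 * t)) (by positivity)
  have e : ∀ z : En n, -‖z‖ ^ 2 / (2 * t) = -(1 / (2 * t)) * ‖z‖ ^ 2 := fun z => by ring
  simp only [gd, e]
  rw [integral_const_mul, h]
  simp only [finrank_euclideanSpace, Fintype.card_fin]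
  rw [show π / (1 / (2 * t)) = 2 * π * t by field_simp, ← Real.rpow_add (by positivity)]
  ring_nf
  simp

lemma gd_integrable {t : ℝ} (ht : 0 < t) : Integrable (gd n t) := by
  by_contra h
  have := gd_integral (n := n) ht
  rw [integral_undef h] at this
  norm_num at this

lemma gs_density {t : ℝ} (ht : 0 < t) :
    gs n t = volume.withDensity (fun z => ((gd n t z).toNNReal : ENNReal)) := by
  have hpi := Real.pi_pos
  have hm : Measurable (fun z => (gd n t z).toNNReal) := (gd_meas t).real_toNNReal
  have hpr : IsProbabilityMeasure (volume.withDensity (fun z => ((gd n t z).toNNReal : ENNReal))) := by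
    constructor
    rw [withDensity_apply _ MeasurableSet.univ, Measure.restrict_univ]
    have := ofReal_integral_eq_lintegral_ofReal (gd_integrable (n := n) ht)
      (Eventually.of_forall fun z => (gd_pos ht z).le)
    rw [gd_integral ht, ENNReal.ofReal_one] at this
    exact this.symm
  apply Measure.ext_of_charFun
  ext x
  rw [charFun_gs ht.le, charFun_apply, integral_withDensity_eq_integral_smul hm]
  have hb : 0 < ((1 / (2 * t) : ℝ) : ℂ).re := by
    rw [Complex.ofReal_re]; positivity
  have h := GaussianFourier.integral_cexp_neg_mul_sq_norm_add (V := En n) hb Complex.I x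
  have e : ∀ z : En n, (gd n t z).toNNReal • Complex.exp (inner ℝ z x * Complex.I) =
      (((2 * π * t) ^ (-(n : ℝ) / 2) : ℝ) : ℂ) *
        Complex.exp (-((1 / (2 * t) : ℝ) : ℂ) * ‖z‖ ^ 2 + Complex.I * inner ℝ x z) := by
    intro z
    rw [NNReal.smul_def, Real.coe_toNNReal _ (gd_pos ht z).le, Complex.real_smul, gd, Complex.ofReal_mul,
      Complex.ofReal_exp, mul_assoc, ← Complex.exp_add, real_inner_comm]
    congr 2
    push_cast
    ring
  simp only [e]
  rw [integral_const_mul, h]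
  simp only [finrank_euclideanSpace, Fintype.card_fin]
  have e1 : ((π : ℂ) / ((1 / (2 * t) : ℝ) : ℂ)) ^ ((n : ℂ) / 2) =
      (((2 * π * t) ^ ((n : ℝ) / 2) : ℝ) : ℂ) := by
    rw [← Complex.ofReal_div, show π / (1 / (2 * t)) = 2 * π * t by field_simp,
      Complex.ofReal_cpow (by positivity)]
    push_cast; rfl
  rw [e1, ← mul_assoc, ← Complex.ofReal_mul, ← Real.rpow_add (by positivity)]
  ring_nf
  rw [Real.rpow_zero, Complex.I_sq]
  push_cast
  have ht' : (t : ℂ) ≠ 0 := by exact_mod_cast ht.ne'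
  rw [one_mul]
  congr 1
  field_simp
  norm_num

lemma gs_integral {t : ℝ} (ht : 0 < t) {F : Type*} [NormedAddCommGroup F] [NormedSpace ℝ F]
    (f : En n → F) : ∫ z, f z ∂(gs n t) = ∫ z, gd n t z • f z := by
  rw [gs_density ht, integral_withDensity_eq_integral_smul (gd_meas t).real_toNNReal]
  congr 1; ext z
  rw [NNReal.smul_def, Real.coe_toNNReal _ (gd_pos ht z).le]

lemma gs_integrable {t : ℝ} (ht : 0 < t) {F : Type*} [NormedAddCommGroup F] [NormedSpace ℝ F]
    (f : En n → F) : Integrable f (gs n t) ↔ Integrable (fun z => gd n t z • f z) := by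
  rw [gs_density ht, integrable_withDensity_iff_integrable_smul (gd_meas t).real_toNNReal]
  apply integrable_congr
  refine Eventually.of_forall fun z => ?_
  simp only []
  rw [NNReal.smul_def, Real.coe_toNNReal _ (gd_pos ht z).le]

end Gauss

end partH

section partI

/-! ### step inequality -/

section Step
variable {n d : ℕ}

/-- correlated Gaussian noise -/
def nu2 (n : ℕ) (h a b : ℝ) : Measure (En n × En n) := (gs n h).map (fun z => (a • z, b • z))

instance nu2Prob (h a b : ℝ) : IsProbabilityMeasure (nu2 n h a b) :=
  Measure.isProbabilityMeasure_map (by fun_prop)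

lemma nu2_mom (h a b : ℝ) : Integrable (fun z => ‖z‖ ^ 2) (nu2 n h a b) := by
  rw [nu2, integrable_map_measure (by fun_prop) (by fun_prop)]
  have := (gs_mom (n := n) h).const_mul ((|a| + |b|) ^ 2)
  refine this.mono' (by fun_prop) (Eventually.of_forall fun z => ?_)
  simp only [Function.comp]
  rw [Real.norm_eq_abs, abs_of_nonneg (by positivity), ← mul_pow]
  refine pow_le_pow_left₀ (norm_nonneg _) ?_ 2
  have h0 := norm_nonneg z
  refine norm_prod_le_iff.2 ⟨?_, ?_⟩
  · rw [norm_smul, Real.norm_eq_abs]; nlinarith [abs_nonneg b]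
  · rw [norm_smul, Real.norm_eq_abs]; nlinarith [abs_nonneg a]

lemma nu2_fst {h : ℝ} (hh : 0 ≤ h) (a b : ℝ) : (nu2 n h a b).map Prod.fst = gs n (a ^ 2 * h) := by
  rw [nu2, Measure.map_map (by fun_prop) (by fun_prop)]
  exact gs_smul hh

lemma nu2_snd {h : ℝ} (hh : 0 ≤ h) (a b : ℝ) : (nu2 n h a b).map Prod.snd = gs n (b ^ 2 * h) := by
  rw [nu2, Measure.map_map (by fun_prop) (by fun_prop)]
  exact gs_smul hh

lemma nu2_sum {h : ℝ} (hh : 0 ≤ h) (a b : ℝ) :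
    (nu2 n h a b).map (fun z => z.1 + z.2) = gs n ((a + b) ^ 2 * h) := by
  rw [nu2, Measure.map_map (by fun_prop) (by fun_prop), ← gs_smul hh]
  congr 1; ext z; simp [add_smul]

/-- A tripartite system with its marginals, satisfying conditional independence. -/
structure Sys (R : En n × En n → Mat d) (X Y W : En n → Mat d) : Prop where
  hR : FE2 (mm n) R
  hX : FE2 volume X
  hY : FE2 volume Y
  hW : FE2 volume W
  mX : IsMarg id R X
  mY : IsMarg Prod.swap R Y
  mW : IsMarg (fun x => (x.2, x.1 - x.2)) R W
  indep : Hent volume X + Hent volume Y ≤ Hent (mm n) R + vnEnt (∫ x, X x)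

variable {R : En n × En n → Mat d} {X Y W : En n → Mat d}

/-- entropy along the heat flow -/
def gH (X : En n → Mat d) (t : ℝ) : ℝ := Hent volume (smooth (gs n t) X)

lemma gH_zero (X : En n → Mat d) : gH X 0 = Hent volume X := by
  rw [gH, gs_zero, smooth_dirac]

lemma gH_gH (hX : FE2 volume X) {s t : ℝ} (hs : 0 ≤ s) (ht : 0 ≤ t) :
    gH (smooth (gs n s) X) t = gH X (s + t) := by
  rw [gH, gH, add_comm, ← gs_add ht hs]
  exact Hent_congr (smooth_smooth hX.toFE)

lemma gH_congr {X' : En n → Mat d} (h : X =ᵐ[volume] X') (t : ℝ) : gH X t = gH X' t :=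
  Hent_congr (smooth_congr h)

lemma gH_concav (hX : FE2 volume X) {r s t : ℝ} (hr : 0 ≤ r) (hs : 0 ≤ s) (ht : 0 ≤ t) :
    gH X r + gH X (r + s + t) ≤ gH X (r + s) + gH X (r + t) := by
  have h := concav (hX.smooth (gs_mom r)) (gs_mom (n := n) t) (gs_mom (n := n) s)
  have h2 := hX.smooth (gs_mom (n := n) r)
  have e1 := gH_gH h2 hs ht
  rw [gH_gH hX hr (by positivity)] at e1
  have e2 := gH_gH hX hr hs
  have e3 := gH_gH hX hr ht
  have e4 : Hent volume (smooth (gs n r) X) = gH X r := rfl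
  rw [gH] at e1 e2 e3
  rw [e1, e2, e3, e4] at h
  rw [add_assoc]; linarith

lemma Sys.smooth (S : Sys R X Y W) {h a b : ℝ} (hh : 0 ≤ h) :
    (FE2 (mm n) (smooth (nu2 n h a b) R)) ∧ FE2 volume (smooth (gs n (a ^ 2 * h)) X) ∧
    FE2 volume (smooth (gs n (b ^ 2 * h)) Y) ∧ FE2 volume (smooth (gs n ((a + b) ^ 2 * h)) W) ∧
    IsMarg id (smooth (nu2 n h a b) R) (smooth (gs n (a ^ 2 * h)) X) ∧
    IsMarg Prod.swap (smooth (nu2 n h a b) R) (smooth (gs n (b ^ 2 * h)) Y) ∧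
    IsMarg (fun x => (x.2, x.1 - x.2)) (smooth (nu2 n h a b) R)
      (smooth (gs n ((a + b) ^ 2 * h)) W) := by
  have m1 := coordX.marg (ν := nu2 n h a b) S.hR.toFE S.hX.toFE S.mX
  have m2 := coordY.marg (ν := nu2 n h a b) S.hR.toFE S.hY.toFE S.mY
  have m3 := coordW.marg (ν := nu2 n h a b) S.hR.toFE S.hW.toFE S.mW
  rw [nu2_fst hh] at m1
  rw [nu2_snd hh] at m2
  rw [nu2_sum hh] at m3
  exact ⟨S.hR.smooth (nu2_mom h a b), S.hX.smooth (gs_mom _), S.hY.smooth (gs_mom _),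
    S.hW.smooth (gs_mom _), m1, m2, m3⟩

lemma Sys.smoothX (S : Sys R X Y W) {h : ℝ} (hh : 0 ≤ h) :
    Sys (_root_.smooth (nu2 n h 1 0) R) (_root_.smooth (gs n h) X) Y (_root_.smooth (gs n h) W) := by
  obtain ⟨h1, h2, h3, h4, h5, h6, h7⟩ := S.smooth (a := 1) (b := 0) hh
  have st := coordX.star S.hR S.hX S.mX (nu2_mom (n := n) h 1 0)
  rw [nu2_fst hh] at st
  norm_num at h2 h3 h4 h5 h6 h7 st
  rw [gs_zero, smooth_dirac] at h3 h6
  refine ⟨h1, h2, h3, h4, h5, h6, h7, ?_⟩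
  rw [integral_smooth S.hX.toFE]
  have := S.indep
  linarith

lemma Sys.smoothY (S : Sys R X Y W) {h : ℝ} (hh : 0 ≤ h) :
    Sys (_root_.smooth (nu2 n h 0 1) R) X (_root_.smooth (gs n h) Y) (_root_.smooth (gs n h) W) := by
  obtain ⟨h1, h2, h3, h4, h5, h6, h7⟩ := S.smooth (a := 0) (b := 1) hh
  have st := coordY.star S.hR S.hY S.mY (nu2_mom (n := n) h 0 1)
  rw [nu2_snd hh] at st
  norm_num at h2 h3 h4 h5 h6 h7 st
  rw [gs_zero, smooth_dirac] at h2 h5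
  refine ⟨h1, h2, h3, h4, h5, h6, h7, ?_⟩
  have := S.indep
  linarith

lemma Sys.step0 (S : Sys R X Y W) {h lam : ℝ} (hh : 0 ≤ h) :
    gH W h - gH W 0 ≤ (gH X (lam ^ 2 * h) - gH X 0) + (gH Y ((1 - lam) ^ 2 * h) - gH Y 0) := by
  obtain ⟨h1, h2, h3, h4, h5, h6, h7⟩ := S.smooth (a := lam) (b := 1 - lam) hh
  have st := coordW.star S.hR S.hW S.mW (nu2_mom (n := n) h lam (1 - lam))
  rw [nu2_sum hh] at st
  have e : (lam + (1 - lam)) ^ 2 * h = h := by ring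
  rw [e] at h4 h7 st
  have sb := subadd2 (NeZero.ne _) h1.toFE h2.toFE h3.toFE h5 h6
  rw [integral_smooth S.hX.toFE] at sb
  have := S.indep
  simp only [gH_zero]
  unfold gH
  linarith

lemma Sys.step (S : Sys R X Y W) {s u h lam : ℝ} (hs : 0 ≤ s) (hu : 0 ≤ u) (hh : 0 ≤ h) :
    gH W (s + u + h) - gH W (s + u) ≤
      (gH X (s + lam ^ 2 * h) - gH X s) + (gH Y (u + (1 - lam) ^ 2 * h) - gH Y u) := by
  have key := ((S.smoothX hs).smoothY hu).step0 (lam := lam) hh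
  have h1 := S.hW.smooth (gs_mom (n := n) s)
  rw [gH_gH h1 hu hh, gH_gH h1 hu le_rfl, gH_gH S.hW hs (by positivity),
    gH_gH S.hW hs (by positivity), gH_gH S.hX hs (by positivity), gH_gH S.hX hs le_rfl,
    gH_gH S.hY hu (by positivity), gH_gH S.hY hu le_rfl] at key
  simpa [add_assoc] using key

end Step

end partI

section partJ

/-! ### L1 convergence of smoothing -/

section Lone
variable {n d : ℕ} {X : En n → Mat d}

/-- modulus of continuity in `L1` -/
def omg (X : En n → Mat d) (v : En n) : ℝ := ∫ a, ‖X (v + a) - X a‖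

lemma omg_cont (hX : Integrable X) : Continuous (omg X) := by
  have : Fact ((1 : ENNReal) ≠ ⊤) := ⟨ENNReal.one_ne_top⟩
  have h1 : MemLp X 1 (volume : Measure (En n)) := memLp_one_iff_integrable.2 hX
  set F := h1.toLp X with hF
  have hc : Continuous (fun v : En n => ‖(DomAddAct.mk v +ᵥ F) - F‖) := by fun_prop
  refine hc.congr fun v => ?_
  rw [hF, DomAddAct.mk_vadd_toLp, ← MemLp.toLp_sub]
  have hi : Integrable (fun a => X (v + a) - X a) := (hX.comp_add_left v).sub hX
  have := L1.norm_of_fun_eq_integral_norm hi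
  exact this

lemma omg_zero : omg X 0 = 0 := by simp [omg]

lemma omg_le (hX : Integrable X) (v : En n) : omg X v ≤ 2 * ∫ a, ‖X a‖ := by
  have h1 := hX.comp_add_left v
  calc omg X v ≤ ∫ a, (‖X (v + a)‖ + ‖X a‖) :=
        integral_mono (h1.sub hX).norm (h1.norm.add hX.norm) fun a => norm_sub_le _ _
    _ = 2 * ∫ a, ‖X a‖ := by
        rw [integral_add h1.norm hX.norm, integral_add_left_eq_self (fun a => ‖X a‖) v]; ring

lemma omg_nonneg (v : En n) : 0 ≤ omg X v := integral_nonneg fun _ => norm_nonneg _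

lemma smooth_sub_le (hX : FE volume X) (t : ℝ) :
    ∫ a, ‖smooth (gs n t) X a - X a‖ ≤ ∫ z, omg X (-(Real.sqrt t • z)) ∂(ProbabilityTheory.stdGaussian (En n)) := by
  have mpf := mp_shift_fst (m := (volume : Measure (En n))) (ν := gs n t) measurable_id
  simp only [id] at mpf
  have hT := (hX.comp mpf).integrable
  have hT2 := (hX.comp (measurePreserving_fst (μ := (volume : Measure (En n))) (ν := gs n t))).integrable
  have hD := (hT.sub hT2).norm
  have e : ∫ z, omg X (-(Real.sqrt t • z)) ∂(ProbabilityTheory.stdGaussian (En n)) =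
      ∫ w, omg X (-w) ∂(gs n t) := by
    rw [gs, integral_map (by fun_prop)]
    exact ((omg_cont hX.integrable).comp continuous_neg).aestronglyMeasurable
  rw [e]
  have e2 : ∫ w, omg X (-w) ∂(gs n t) = ∫ a, ∫ w, ‖X (a - w) - X a‖ ∂(gs n t) := by
    rw [integral_integral_swap hD]
    congr 1; ext w; rw [omg]
    congr 1; ext a; rw [neg_add_eq_sub]
  rw [e2]
  refine integral_mono_ae ?_ hD.integral_prod_left ?_
  · have hs : Integrable (smooth (gs n t) X) := hT.integral_prod_left
    exact (hs.sub hX.integrable).norm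
  · filter_upwards [hT.prod_right_ae] with a ha
    have : smooth (gs n t) X a - X a = ∫ w, (X (a - w) - X a) ∂(gs n t) := by
      rw [integral_sub ha (integrable_const _)]; simp [smooth]
    rw [this]
    exact norm_integral_le_integral_norm _

lemma smooth_tendsto (hX : FE volume X) {t : ℕ → ℝ} (ht : Tendsto t atTop (𝓝 0)) :
    Tendsto (fun k => ∫ a, ‖smooth (gs n (t k)) X a - X a‖) atTop (𝓝 0) := by
  have hc := omg_cont hX.integrable
  refine squeeze_zero (fun k => integral_nonneg fun _ => norm_nonneg _)
    (fun k => smooth_sub_le hX (t k)) ?_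
  have : Tendsto (fun k => ∫ z, omg X (-(Real.sqrt (t k) • z)) ∂(ProbabilityTheory.stdGaussian (En n)))
      atTop (𝓝 (∫ z, (0 : ℝ) ∂(ProbabilityTheory.stdGaussian (En n)))) := by
    refine tendsto_integral_of_dominated_convergence (fun _ => 2 * ∫ a, ‖X a‖) ?_
      (integrable_const _) ?_ ?_
    · intro k
      exact (hc.comp (by fun_prop : Continuous fun z : En n => -(Real.sqrt (t k) • z))).aestronglyMeasurable
    · intro k
      refine Eventually.of_forall fun z => ?_
      rw [Real.norm_eq_abs, abs_of_nonneg (omg_nonneg _)]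
      exact omg_le hX.integrable _
    · refine Eventually.of_forall fun z => ?_
      have h1 : Tendsto (fun k => -(Real.sqrt (t k) • z)) atTop (𝓝 (-(Real.sqrt 0 • z))) :=
        (((Real.continuous_sqrt.tendsto 0).comp ht).smul_const z).neg
      have := (hc.tendsto _).comp h1
      simpa [omg_zero, Function.comp_def] using this
  simpa using this

lemma smooth_ae_subseq (hX : FE volume X) {t : ℕ → ℝ} (ht : Tendsto t atTop (𝓝 0)) :
    ∃ ns : ℕ → ℕ, StrictMono ns ∧ ∀ᵐ a, Tendsto (fun k => smooth (gs n (t (ns k))) X a) atTop (𝓝 (X a)) := by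
  have hs : ∀ k, Integrable (smooth (gs n (t k)) X) := fun k => by
    have mpf := mp_shift_fst (m := (volume : Measure (En n))) (ν := gs n (t k)) measurable_id
    exact (hX.comp mpf).integrable.integral_prod_left
  have hm : TendstoInMeasure volume (fun k => smooth (gs n (t k)) X) atTop X := by
    refine tendstoInMeasure_of_tendsto_eLpNorm (p := 1) one_ne_zero (fun k => (hs k).1)
      hX.integrable.1 ?_
    have h := ENNReal.tendsto_ofReal (smooth_tendsto hX ht)
    rw [ENNReal.ofReal_zero] at h
    refine h.congr fun k => ?_
    rw [eLpNorm_one_eq_lintegral_enorm]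
    exact ofReal_integral_norm_eq_lintegral_enorm ((hs k).sub hX.integrable)
  exact hm.exists_seq_tendsto_ae

lemma vnEnt_tendsto {A : ℕ → Mat d} {B : Mat d} (hA : ∀ k, (A k).IsHermitian) (hB : B.IsHermitian)
    (h : Tendsto A atTop (𝓝 B)) : Tendsto (fun k => vnEnt (A k)) atTop (𝓝 (vnEnt B)) := by
  have h1 := ((continuous_cfc_herm (d := d) continuous_negMulLog).tendsto B).comp h
  have h2 := ((rtrL (d := d)).continuous.tendsto _).comp h1
  simp only [Function.comp_def, herm_half (hA _), herm_half hB, rtrL_apply] at h2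
  rw [vnEnt_eq_rtr hB]
  exact h2.congr fun k => (vnEnt_eq_rtr (hA k)).symm

/-- Fatou -/
lemma fatou_real {α : Type*} [MeasurableSpace α] {μ : Measure α} {F : ℕ → α → ℝ} {G : α → ℝ}
    (hF : ∀ k, Integrable (F k) μ) (hG : Integrable G μ) (F0 : ∀ k a, 0 ≤ F k a)
    (G0 : ∀ a, 0 ≤ G a)
    (hlim : ∀ᵐ a ∂μ, Tendsto (fun k => F k a) atTop (𝓝 (G a))) {b : ℕ → ℝ} {c : ℝ}
    (hb : ∀ k, ∫ a, F k a ∂μ ≤ b k) (hc : Tendsto b atTop (𝓝 c)) : ∫ a, G a ∂μ ≤ c := by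
  have h1 : ∫⁻ a, liminf (fun k => ENNReal.ofReal (F k a)) atTop ∂μ ≤
      liminf (fun k => ∫⁻ a, ENNReal.ofReal (F k a) ∂μ) atTop :=
    lintegral_liminf_le' fun k => (hF k).1.aemeasurable.ennreal_ofReal
  have h2 : ∫⁻ a, liminf (fun k => ENNReal.ofReal (F k a)) atTop ∂μ = ∫⁻ a, ENNReal.ofReal (G a) ∂μ := by
    refine lintegral_congr_ae (hlim.mono fun a ha => ?_)
    exact (ENNReal.tendsto_ofReal ha).liminf_eq
  rw [h2, ← ofReal_integral_eq_lintegral_ofReal hG (Eventually.of_forall G0)] at h1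
  have h3 : liminf (fun k => ∫⁻ a, ENNReal.ofReal (F k a) ∂μ) atTop ≤
      liminf (fun k => ENNReal.ofReal (b k)) atTop := by
    refine liminf_le_liminf (Eventually.of_forall fun k => ?_)
    rw [← ofReal_integral_eq_lintegral_ofReal (hF k) (Eventually.of_forall (F0 k))]
    exact ENNReal.ofReal_le_ofReal (hb k)
  rw [(ENNReal.tendsto_ofReal hc).liminf_eq] at h3
  have h4 := h1.trans h3
  have hc0 : 0 ≤ c := ge_of_tendsto' hc fun k => (integral_nonneg (F0 k)).trans (hb k)
  exact (ENNReal.ofReal_le_ofReal_iff hc0).1 h4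

end Lone

end partJ

section partK

/-! ### Gaussian bounds -/

lemma vnEnt_smul {d : ℕ} {A : Mat d} (hA : A.IsHermitian) (c : ℝ) :
    vnEnt (c • A) = c * vnEnt A + negMulLog c * rtr A := by
  have hcA : (c • A).IsHermitian := by
    rw [Matrix.IsHermitian, Matrix.conjTranspose_smul, hA.eq]; simp
  have hsa : IsSelfAdjoint A := hA
  rw [vnEnt_eq_rtr hcA, ← cfc_comp_const_mul c negMulLog A continuous_negMulLog.continuousOn,
    rtr_cfc hA, vnEnt_eq hA, rtr_eq_sum hA, Finset.mul_sum, Finset.mul_sum, ← Finset.sum_add_distrib]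
  refine Finset.sum_congr rfl fun i _ => ?_
  rw [negMulLog_mul]; ring

lemma klein_smul {d : ℕ} {A M : Mat d} (hA : A.PosSemidef) (hM : M.PosDef) {c : ℝ} (hc : 0 < c) :
    vnEnt A ≤ -Real.log c * rtr A - rtr (A * cfc Real.log M) - rtr A + c * rtr M := by
  have h := klein hA (hM.smul hc)
  have hsa : IsSelfAdjoint M := hM.1
  have e : cfc Real.log (c • M) = algebraMap ℝ (Mat d) (Real.log c) + cfc Real.log M := by
    refine CFC.log_smul M (fun x hx => ?_) hc.ne' hsa
    rw [hM.1.spectrum_real_eq_range_eigenvalues] at hx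
    obtain ⟨i, rfl⟩ := hx
    exact (hM.eigenvalues_pos i).ne'
  rw [qD, e, mul_add, rtr_add, Algebra.algebraMap_eq_smul_one, mul_smul_comm, mul_one, rtr_smul,
    rtr_smul] at h
  linarith

section Bounds
variable {n d : ℕ} {X : En n → Mat d}

lemma mass_smooth (hX : FE volume X) (ν : Measure (En n)) [IsProbabilityMeasure ν] :
    ∫ a, rtr (smooth ν X a) = ∫ a, rtr (X a) := by
  rw [← rtr_integral (sm_smooth hX.sm) (psd_smooth hX.psd), integral_smooth hX,
    rtr_integral hX.sm hX.psd]

lemma sq_bound {θ a b c : ℝ} (hθ : 0 < θ) (h0 : 0 ≤ c) (h : c ≤ a + b) :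
    c ^ 2 ≤ (1 + θ) * a ^ 2 + (1 + 1 / θ) * b ^ 2 := by
  have h1 : c ^ 2 ≤ (a + b) ^ 2 := pow_le_pow_left₀ h0 h 2
  have h2 : (1 + θ) * a ^ 2 + (1 + 1 / θ) * b ^ 2 - (a + b) ^ 2 = (θ * a - b) ^ 2 / θ := by
    field_simp; ring
  have h3 : 0 ≤ (θ * a - b) ^ 2 / θ := by positivity
  linarith

/-- second moment -/
def mom2 (X : En n → Mat d) : ℝ := ∫ a, ‖a‖ ^ 2 * rtr (X a)

lemma mom_smooth (hX : FE2 volume X) (mass : ∫ a, rtr (X a) = 1) {t θ : ℝ} (ht : 0 ≤ t) (hθ : 0 < θ) :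
    mom2 (smooth (gs n t) X) ≤ (1 + θ) * mom2 X + (1 + 1 / θ) * (t * c2 n) := by
  set ν := gs n t with hν
  have hνm : Integrable (fun z => ‖z‖ ^ 2) ν := gs_mom t
  have mp := mp_shift (m := (volume : Measure (En n))) (ν := ν) measurable_id
  have mpf := mp_shift_fst (m := (volume : Measure (En n))) (ν := ν) measurable_id
  simp only [id] at mp mpf
  have hT := hX.toFE.comp mpf
  have hr : ∀ a, rtr (_root_.smooth ν X a) = ∫ z, rtr (X (a - z)) ∂ν := fun a =>
    rtr_integral (hX.sm.comp_measurable (by fun_prop)) (fun _ => hX.psd _)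
  have i1 : Integrable (fun x : En n × En n => ‖x.1 - x.2‖ ^ 2 * rtr (X (x.1 - x.2))) (volume.prod ν) :=
    (mpf.integrable_comp hX.mom.1).2 hX.mom
  have i2 : Integrable (fun x : En n × En n => rtr (X (x.1 - x.2)) * ‖x.2‖ ^ 2) (volume.prod ν) :=
    (mp.integrable_comp (hX.int.mul_prod hνm).1).2 (hX.int.mul_prod hνm)
  have hle : ∀ x : En n × En n, ‖x.1‖ ^ 2 * rtr (X (x.1 - x.2)) ≤
      (1 + θ) * (‖x.1 - x.2‖ ^ 2 * rtr (X (x.1 - x.2))) +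
        (1 + 1 / θ) * (rtr (X (x.1 - x.2)) * ‖x.2‖ ^ 2) := by
    intro x
    have h0 := rtr_nonneg (hX.psd (x.1 - x.2))
    have h1 : ‖x.1‖ ≤ ‖x.1 - x.2‖ + ‖x.2‖ := by
      calc ‖x.1‖ = ‖(x.1 - x.2) + x.2‖ := by simp
        _ ≤ _ := norm_add_le _ _
    have h2 := mul_le_mul_of_nonneg_right (sq_bound hθ (norm_nonneg _) h1) h0
    linarith
  have iR := (i1.const_mul (1 + θ)).add (i2.const_mul (1 + 1 / θ))
  have hmomT : Integrable (fun x : En n × En n => ‖x.1‖ ^ 2 * rtr (X (x.1 - x.2))) (volume.prod ν) := by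
    refine iR.mono' ?_ (Eventually.of_forall fun x => ?_)
    · exact ((measurable_fst.norm.pow_const 2).aestronglyMeasurable).mul hT.int.1
    · have h0 := rtr_nonneg (hX.psd (x.1 - x.2))
      rw [Real.norm_eq_abs, abs_of_nonneg (by positivity)]
      exact hle x
  have e0 : mom2 (smooth ν X) = ∫ x : En n × En n, ‖x.1‖ ^ 2 * rtr (X (x.1 - x.2)) ∂(volume.prod ν) := by
    rw [integral_prod _ hmomT, mom2]
    simp only [hr, ← integral_const_mul]
  have e1 : ∫ x : En n × En n, ‖x.1 - x.2‖ ^ 2 * rtr (X (x.1 - x.2)) ∂(volume.prod ν) = mom2 X := by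
    have := integral_map (f := fun a => ‖a‖ ^ 2 * rtr (X a)) mpf.measurable.aemeasurable
      (by rw [mpf.map_eq]; exact hX.mom.1)
    rw [mpf.map_eq] at this
    exact this.symm
  have e2 : ∫ x : En n × En n, rtr (X (x.1 - x.2)) * ‖x.2‖ ^ 2 ∂(volume.prod ν) = t * c2 n := by
    have := integral_map (f := fun x : En n × En n => rtr (X x.1) * ‖x.2‖ ^ 2)
      mp.measurable.aemeasurable (by rw [mp.map_eq]; exact (hX.int.mul_prod hνm).1)
    rw [mp.map_eq, integral_prod_mul (fun a => rtr (X a)) (fun z : En n => ‖z‖ ^ 2), mass,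
      hν, gs_mom_eq ht, one_mul] at this
    exact this.symm
  rw [e0]
  calc _ ≤ ∫ x : En n × En n, ((1 + θ) * (‖x.1 - x.2‖ ^ 2 * rtr (X (x.1 - x.2))) +
        (1 + 1 / θ) * (rtr (X (x.1 - x.2)) * ‖x.2‖ ^ 2)) ∂(volume.prod ν) :=
        integral_mono hmomT iR hle
    _ = _ := by
        rw [integral_add (i1.const_mul _) (i2.const_mul _), integral_const_mul, integral_const_mul, e1, e2]

/-- maximum entropy bound -/
lemma Hent_gauss (hX : FE2 volume X) (mass : ∫ a, rtr (X a) = 1) {t : ℝ} (ht : 0 < t) :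
    Hent volume X ≤ vnEnt (∫ a, X a) + (n : ℝ) / 2 * Real.log (2 * π * t) + mom2 X / (2 * t) := by
  refine le_of_forall_pos_le_add fun ε' hε' => ?_
  set ε : ℝ := ε' / (d + 1) with hε
  have hε0 : 0 < ε := by positivity
  set M0 := ∫ a, X a with hM0
  have hM0p : M0.PosSemidef := psd_integral hX.psd
  set M := M0 + ε • (1 : Mat d) with hM
  have hMp : M.PosDef := posDef_add_smul hM0p hε0
  have hM1 : rtr M0 = 1 := by rw [hM0, rtr_integral hX.sm hX.psd, mass]
  have hrM : rtr M = 1 + ε * d := by rw [hM, rtr_add, rtr_smul, rtr_one, hM1]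
  set K := cfc Real.log M with hK
  have iK : Integrable (fun a => rtr (X a * K)) := (rtrMulL K).integrable_comp hX.toFE.integrable
  have eK : ∫ a, rtr (X a * K) = rtr (M0 * K) :=
    (rtrMulL K).integral_comp_comm hX.toFE.integrable
  set q := (n : ℝ) / 2 * Real.log (2 * π * t) with hq
  have hpt : ∀ a, vnEnt (X a) ≤ (q - 1) * rtr (X a) + (1 / (2 * t)) * (‖a‖ ^ 2 * rtr (X a)) -
      rtr (X a * K) + gd n t a * rtr M := by
    intro a
    have := klein_smul (hX.psd a) hMp (gd_pos ht a)
    rw [gd_log ht] at this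
    refine this.trans_eq ?_
    rw [← hK, ← hq]; ring
  have j1 := hX.int.const_mul (q - 1)
  have j2 := hX.mom.const_mul (1 / (2 * t))
  have j3 := (gd_integrable (n := n) ht).mul_const (rtr M)
  have h1 : Hent volume X ≤ ∫ a, ((q - 1) * rtr (X a) + (1 / (2 * t)) * (‖a‖ ^ 2 * rtr (X a)) -
      rtr (X a * K) + gd n t a * rtr M) :=
    integral_mono hX.toFE.vn (((j1.add j2).sub iK).add j3) hpt
  have e1 := integral_add ((j1.add j2).sub iK) j3
  have e2 := integral_sub (j1.add j2) iK
  have e3 := integral_add j1 j2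
  simp only [Pi.add_apply, Pi.sub_apply] at e1 e2 e3
  rw [e1, e2, e3, integral_const_mul, integral_const_mul, integral_mul_const, gd_integral ht, mass, eK, hrM] at h1
  have h2 := (self_log_bounds hM0p hε0).1
  rw [← hM, ← hK] at h2
  have h3 : ε * d ≤ ε' := by
    rw [hε, div_mul_eq_mul_div, div_le_iff₀ (by positivity)]
    nlinarith
  have h4 : mom2 X / (2 * t) = 1 / (2 * t) * ∫ a, ‖a‖ ^ 2 * rtr (X a) := by rw [mom2]; ring
  linarith

lemma gH_upper (hX : FE2 volume X) (mass : ∫ a, rtr (X a) = 1) {t θ : ℝ} (ht : 0 < t) (hθ : 0 < θ) :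
    gH X t ≤ vnEnt (∫ a, X a) + (n : ℝ) / 2 * Real.log (2 * π * t) +
      ((1 + 1 / θ) * mom2 X / t + (1 + θ) * c2 n) / 2 := by
  have hs := hX.smooth (gs_mom (n := n) t)
  have h1 := Hent_gauss hs (by rw [mass_smooth hX.toFE, mass]) ht
  have h2 := mom_smooth hX mass ht.le (θ := 1 / θ) (by positivity)
  rw [integral_smooth hX.toFE] at h1
  rw [one_div_one_div] at h2
  refine h1.trans ?_
  have h3 : mom2 (smooth (gs n t) X) / (2 * t) ≤
      ((1 + 1 / θ) * mom2 X + (1 + θ) * (t * c2 n)) / (2 * t) := by gcongr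
  have h4 : ((1 + 1 / θ) * mom2 X + (1 + θ) * (t * c2 n)) / (2 * t) =
      ((1 + 1 / θ) * mom2 X / t + (1 + θ) * c2 n) / 2 := by field_simp
  linarith

lemma gH_usc (hX : FE2 volume X) (mass : ∫ a, rtr (X a) = 1) {C : ℝ} (hC : ∀ t > 0, C ≤ gH X t) :
    C ≤ gH X 0 := by
  have ht : Tendsto (fun k : ℕ => 1 / ((k : ℝ) + 1)) atTop (𝓝 0) := tendsto_one_div_add_atTop_nhds_zero_nat
  have ht0 : ∀ k : ℕ, 0 < 1 / ((k : ℝ) + 1) := fun k => by positivity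
  obtain ⟨ns, hns, hae⟩ := smooth_ae_subseq hX.toFE ht
  set t : ℕ → ℝ := fun k => 1 / ((ns k : ℝ) + 1) with htd
  have htt : Tendsto t atTop (𝓝 0) := ht.comp hns.tendsto_atTop
  have htp : ∀ k, 0 < t k := fun k => ht0 _
  set F : (En n → Mat d) → En n → ℝ := fun Z a =>
    -vnEnt (Z a) - Real.log (gd n 1 a) * rtr (Z a) - rtr (Z a) + gd n 1 a * d with hF
  have hF0 : ∀ Z : En n → Mat d, (∀ a, (Z a).PosSemidef) → ∀ a, 0 ≤ F Z a := by
    intro Z hZ a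
    have h := klein_smul (hZ a) Matrix.PosDef.one (gd_pos one_pos a)
    have e : cfc Real.log (1 : Mat d) = 0 := CFC.log_one
    rw [e, mul_zero, rtr_zero, rtr_one] at h
    simp only [hF]; linarith
  set q := (n : ℝ) / 2 * Real.log (2 * π * 1) with hq
  have hFe : ∀ Z : En n → Mat d, F Z = fun a => -vnEnt (Z a) + ((q - 1) * rtr (Z a) +
      (1 / 2) * (‖a‖ ^ 2 * rtr (Z a))) + gd n 1 a * d := by
    intro Z; ext a; simp only [hF]; rw [gd_log one_pos, ← hq]; ring
  have hFi : ∀ Z : En n → Mat d, FE2 volume Z → (∫ a, rtr (Z a) = 1) →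
      Integrable (F Z) ∧ ∫ a, F Z a = -Hent volume Z + ((q - 1) + (1 / 2) * mom2 Z) + d := by
    intro Z hZ hm
    have j1 := hZ.int.const_mul (q - 1)
    have j2 := hZ.mom.const_mul (1 / 2)
    have j3 := (gd_integrable (n := n) one_pos).mul_const (d : ℝ)
    have j0 := hZ.toFE.vn.neg
    have j := (j0.add (j1.add j2)).add j3
    rw [hFe]
    refine ⟨j, ?_⟩
    have e1 := integral_add (j0.add (j1.add j2)) j3
    have e2 := integral_add j0 (j1.add j2)
    have e3 := integral_add j1 j2
    simp only [Pi.add_apply, Pi.neg_apply] at e1 e2 e3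
    rw [e1, e2, e3, integral_neg, integral_const_mul, integral_const_mul, integral_mul_const,
      gd_integral one_pos, hm, Hent, mom2]
    ring
  have hs : ∀ k, FE2 volume (smooth (gs n (t k)) X) := fun k => hX.smooth (gs_mom _)
  have hsm : ∀ k, ∫ a, rtr (smooth (gs n (t k)) X a) = 1 := fun k => by
    rw [mass_smooth hX.toFE, mass]
  rw [gH_zero]
  -- main estimate for every `θ`
  have main : ∀ θ > 0, -Hent volume X + (1 / 2) * mom2 X ≤ -C + (1 / 2) * ((1 + θ) * mom2 X) := by
    intro θ hθ
    have := fatou_real (μ := (volume : Measure (En n))) (F := fun k => F (smooth (gs n (t k)) X)) (G := F X)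
      (b := fun k => -C + ((q - 1) + (1 / 2) *
        ((1 + θ) * mom2 X + (1 + 1 / θ) * (t k * c2 n))) + d)
      (c := -C + ((q - 1) + (1 / 2) * ((1 + θ) * mom2 X + (1 + 1 / θ) * (0 * c2 n))) + d)
      (fun k => (hFi _ (hs k) (hsm k)).1) (hFi X hX mass).1
      (fun k => hF0 _ (hs k).psd) (hF0 X hX.psd) ?_ ?_ ?_
    · rw [(hFi X hX mass).2] at this
      linarith
    · filter_upwards [hae] with a ha
      have h1 := vnEnt_tendsto (fun k => ((hs k).psd a).1) (hX.psd a).1 ha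
      have h2 : Tendsto (fun k => rtr (smooth (gs n (t k)) X a)) atTop (𝓝 (rtr (X a))) := by
        have := ((rtrL (d := d)).continuous.tendsto _).comp ha
        simp only [Function.comp_def, rtrL_apply] at this
        exact this
      exact ((h1.neg.sub (h2.const_mul _)).sub h2).add_const _
    · intro k
      rw [(hFi _ (hs k) (hsm k)).2]
      have h1 := mom_smooth hX mass (htp k).le hθ
      have h2 := hC _ (htp k)
      rw [gH] at h2
      linarith
    · exact ((((htt.mul_const _).const_mul _).const_add _).const_mul _ |>.const_add _ |>.const_add _).add_const _
  have lim : Tendsto (fun θ : ℝ => -C + (1 / 2) * ((1 + θ) * mom2 X)) (𝓝[>] 0)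
      (𝓝 (-C + (1 / 2) * ((1 + 0) * mom2 X))) := by
    refine tendsto_nhdsWithin_of_tendsto_nhds ?_
    exact (by fun_prop : Continuous fun θ : ℝ => -C + (1 / 2) * ((1 + θ) * mom2 X)).tendsto 0
  have := ge_of_tendsto lim (eventually_nhdsWithin_of_forall fun θ hθ => main θ hθ)
  linarith

end Bounds

end partK

section partL

/-! ### lower bound -/

section Lower
variable {n d : ℕ} {X : En n → Mat d}

lemma gH_lower (hX : FE2 volume X) (mass : ∫ a, rtr (X a) = 1) {t : ℝ} (ht : 0 < t) :
    vnEnt (∫ a, X a) + (n : ℝ) / 2 * Real.log (2 * π * t) + c2 n / 2 ≤ gH X t := by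
  set q := (n : ℝ) / 2 * Real.log (2 * π * t) with hq
  have hg := gd_integrable (n := n) ht
  have hmg : Integrable (fun z : En n => gd n t z * ‖z‖ ^ 2) := by
    have := (gs_integrable ht (fun z : En n => ‖z‖ ^ 2)).1 (gs_mom t)
    simpa using this
  have hmge : ∫ z : En n, gd n t z * ‖z‖ ^ 2 = t * c2 n := by
    rw [← gs_mom_eq ht.le, gs_integral ht]; simp
  have hneg : ∀ z, negMulLog (gd n t z) = q * gd n t z + (1 / (2 * t)) * (gd n t z * ‖z‖ ^ 2) := by
    intro z; rw [negMulLog, gd_log ht, ← hq]; ring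
  have hent : Integrable (fun z => negMulLog (gd n t z)) := by
    simp only [hneg]; exact (hg.const_mul q).add (hmg.const_mul _)
  have hente : ∫ z, negMulLog (gd n t z) = q + c2 n / 2 := by
    simp only [hneg]
    rw [integral_add (hg.const_mul q) (hmg.const_mul _), integral_const_mul, integral_const_mul,
      gd_integral ht, hmge]
    field_simp
  set K0 : En n × En n → Mat d := fun x => gd n t x.1 • X x.2 with hK0
  have hr : ∀ x, rtr (K0 x) = gd n t x.1 * rtr (X x.2) := fun x => rtr_smul _ _
  have hFE0 : FE (mm n) K0 := by
    refine ⟨?_, ?_, ?_, ?_⟩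
    · exact ((gd_meas t).comp measurable_fst).stronglyMeasurable.smul
        (hX.sm.comp_measurable measurable_snd)
    · intro x; exact (hX.psd x.2).smul (gd_pos ht x.1).le
    · simp only [hr]; exact hg.mul_prod hX.int
    · simp only [hr]
      have := (hent.mul_prod hX.int).neg.add (hg.mul_prod hX.ent)
      refine this.congr (Eventually.of_forall fun x => ?_)
      simp only [Pi.add_apply, Pi.neg_apply]
      rcases eq_or_ne (rtr (X x.2)) 0 with h0 | h0
      · rw [h0]; simp
      · rw [Real.log_mul (gd_pos ht x.1).ne' h0, negMulLog]; ring
  have hH0 : Hent (mm n) K0 = Hent volume X + (q + c2 n / 2) := by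
    have e : ∀ x, vnEnt (K0 x) = gd n t x.1 * vnEnt (X x.2) + negMulLog (gd n t x.1) * rtr (X x.2) :=
      fun x => vnEnt_smul (hX.psd x.2).1 _
    rw [Hent]
    simp only [e]
    rw [integral_add (hg.mul_prod hX.toFE.vn) (hent.mul_prod hX.int),
      integral_prod_mul (gd n t) (fun a => vnEnt (X a)),
      integral_prod_mul (fun z => negMulLog (gd n t z)) (fun a => rtr (X a)), gd_integral ht, mass, hente,
      Hent]
    ring
  have mp := mp_shift (m := (volume : Measure (En n))) (ν := (volume : Measure (En n))) measurable_id
  have hK := hFE0.comp mp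
  have hs := hX.smooth (gs_mom (n := n) t)
  have key := subadd2 (NeZero.ne _) hK hs.toFE hX.toFE
    (Eventually.of_forall fun b => by
      simp only [hK0, id, smooth]
      rw [gs_integral ht, ← integral_sub_left_eq_self _ volume b]
      simp)
    (Eventually.of_forall fun w => by
      simp only [hK0, id]
      rw [integral_smul_const, integral_sub_right_eq_self (gd n t) w, gd_integral ht, one_smul])
  rw [Hent_comp hFE0 mp, hH0, integral_smooth hX.toFE] at key
  rw [gH]; linarith

end Lower

end partL

section partM

/-! ### real analysis -/

/-- decreasing increments -/
def DecInc (x : ℝ → ℝ) : Prop :=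
  ∀ r s t, 0 ≤ r → 0 ≤ s → 0 ≤ t → x r + x (r + s + t) ≤ x (r + s) + x (r + t)

lemma inc_up {x : ℝ → ℝ} (hx : DecInc x) {s η : ℝ} (hs : 0 ≤ s) (hη : 0 ≤ η) (p : ℕ) :
    x (s + p * η) - x s ≤ p * (x (s + η) - x s) := by
  induction p with
  | zero => simp
  | succ k ih =>
    have := hx s (k * η) η hs (by positivity) hη
    have e : s + ((k + 1 : ℕ) : ℝ) * η = s + k * η + η := by push_cast; ring
    rw [e]; push_cast; linarith

lemma inc_down {x : ℝ → ℝ} (hx : DecInc x) {s η : ℝ} (hη : 0 ≤ η) (q : ℕ) (hs : q * η ≤ s) :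
    q * (x (s + η) - x s) ≤ x s - x (s - q * η) := by
  induction q with
  | zero => simp
  | succ k ih =>
    push_cast at hs
    have := hx (s - (k + 1) * η) ((k + 1) * η) η (by linarith) (by positivity) hη
    have e : s - (k + 1) * η + η = s - k * η := by ring
    have ih' := ih (by linarith)
    rw [sub_add_cancel, e] at this
    push_cast; linarith

lemma inc {x : ℝ → ℝ} (hx : DecInc x) {s η : ℝ} (hη : 0 ≤ η) (p : ℕ) {q : ℕ} (hq : 0 < q)
    (hs : q * η ≤ s) : x (s + p * η) - x s ≤ (p / q : ℝ) * (x s - x (s - q * η)) := by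
  have hq' : (0 : ℝ) < q := by exact_mod_cast hq
  have h0 : 0 ≤ s := le_trans (by positivity) hs
  have h1 := inc_up hx h0 hη p
  have h2 := inc_down hx hη q hs
  have h3 : x (s + η) - x s ≤ (x s - x (s - q * η)) / q := by
    rw [le_div_iff₀ hq']; linarith
  calc _ ≤ (p : ℝ) * (x (s + η) - x s) := h1
    _ ≤ p * ((x s - x (s - q * η)) / q) := by gcongr
    _ = _ := by ring

lemma chain {x y w : ℝ → ℝ} (hx : DecInc x) (hy : DecInc y)
    (step : ∀ s u h lam : ℝ, 0 ≤ s → 0 ≤ u → 0 ≤ h → w (s + u + h) - w (s + u) ≤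
      (x (s + lam ^ 2 * h) - x s) + (y (u + (1 - lam) ^ 2 * h) - y u))
    {p r : ℕ} (hp : 0 < p) {T lam : ℝ} (hlam : lam = p / ((p + r : ℕ) : ℝ)) (hT : 0 ≤ T) (N : ℕ) :
    w ((N + 1) * T) - w T ≤ lam * (x (N * (lam * T)) - x 0)
      + (1 - lam) * (y (N * ((1 - lam) * T)) - y 0) := by
  set q := p + r with hq
  have hq0 : 0 < q := by omega
  have hq' : (0 : ℝ) < q := by exact_mod_cast hq0
  have hqr : (q : ℝ) = p + r := by rw [hq]; push_cast; ring
  have hlam1 : 1 - lam = r / q := by rw [hlam]; field_simp; rw [hqr]; ring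
  have hl0 : 0 ≤ lam := by rw [hlam]; positivity
  have hl1 : 0 ≤ 1 - lam := by rw [hlam1]; positivity
  induction N with
  | zero => simp
  | succ k ih =>
    set s := ((k : ℝ) + 1) * (lam * T) with hs
    set u := ((k : ℝ) + 1) * ((1 - lam) * T) with hu
    have hs0 : 0 ≤ s := by positivity
    have hu0 : 0 ≤ u := by positivity
    have st := step s u T lam hs0 hu0 hT
    have hsu : s + u = (k + 1) * T := by rw [hs, hu]; ring
    have hk : (0 : ℝ) ≤ k := by positivity
    have ix := inc hx (s := s) (η := p * (T / q ^ 2)) (by positivity) p hq0 (by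
      have : (q : ℝ) * (p * (T / q ^ 2)) = lam * T := by rw [hlam]; field_simp
      rw [this, hs]
      have : 0 ≤ lam * T := by positivity
      nlinarith)
    have iy := inc hy (s := u) (η := r * (T / q ^ 2)) (by positivity) r hq0 (by
      have : (q : ℝ) * (r * (T / q ^ 2)) = (1 - lam) * T := by rw [hlam1]; field_simp
      rw [this, hu]
      have : 0 ≤ (1 - lam) * T := by positivity
      nlinarith)
    have a1 : s + (p : ℝ) * (p * (T / q ^ 2)) = s + lam ^ 2 * T := by rw [hlam]; field_simp
    have a2 : s - (q : ℝ) * (p * (T / q ^ 2)) = k * (lam * T) := by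
      have : (q : ℝ) * (p * (T / q ^ 2)) = lam * T := by rw [hlam]; field_simp
      rw [this, hs]; ring
    have b1 : u + (r : ℝ) * (r * (T / q ^ 2)) = u + (1 - lam) ^ 2 * T := by rw [hlam1]; field_simp
    have b2 : u - (q : ℝ) * (r * (T / q ^ 2)) = k * ((1 - lam) * T) := by
      have : (q : ℝ) * (r * (T / q ^ 2)) = (1 - lam) * T := by rw [hlam1]; field_simp
      rw [this, hu]; ring
    rw [a1, a2, ← hlam] at ix
    rw [b1, b2, ← hlam1] at iy
    rw [hsu] at st
    have e : (((k + 1 : ℕ) : ℝ) + 1) * T = (k + 1) * T + T := by push_cast; ring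
    rw [e]
    push_cast
    rw [← hs, ← hu]
    nlinarith

lemma chain_limit {x y w : ℝ → ℝ} (hx : DecInc x) (hy : DecInc y)
    (step : ∀ s u h lam : ℝ, 0 ≤ s → 0 ≤ u → 0 ≤ h → w (s + u + h) - w (s + u) ≤
      (x (s + lam ^ 2 * h) - x s) + (y (u + (1 - lam) ^ 2 * h) - y u))
    {S ν c mx my : ℝ} (hν : 0 ≤ ν)
    (hw : ∀ t > 0, S + ν * Real.log (2 * π * t) + c / 2 ≤ w t)
    (hxu : ∀ t > 0, ∀ θ > 0, x t ≤ S + ν * Real.log (2 * π * t) + ((1 + 1 / θ) * mx / t + (1 + θ) * c) / 2)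
    (hyu : ∀ t > 0, ∀ θ > 0, y t ≤ S + ν * Real.log (2 * π * t) + ((1 + 1 / θ) * my / t + (1 + θ) * c) / 2)
    {p r : ℕ} (hp : 0 < p) (hr : 0 < r) {T lam : ℝ} (hlam : lam = p / ((p + r : ℕ) : ℝ)) (hT : 0 < T) :
    lam * x 0 + (1 - lam) * y 0 + ν * (negMulLog lam + negMulLog (1 - lam)) ≤ w T := by
  have hpi := Real.pi_pos
  have hp' : (0 : ℝ) < p := by exact_mod_cast hp
  have hr' : (0 : ℝ) < r := by exact_mod_cast hr
  have hl0 : 0 < lam := by rw [hlam]; positivity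
  have hl1 : 0 < 1 - lam := by
    have : 1 - lam = r / ((p + r : ℕ) : ℝ) := by rw [hlam]; push_cast; field_simp; ring
    rw [this]; positivity
  have main : ∀ θ > 0, ∀ N : ℕ, 0 < N → lam * x 0 + (1 - lam) * y 0 +
      ν * (negMulLog lam + negMulLog (1 - lam)) ≤
      w T + ((1 + 1 / θ) * (mx + my) / T / 2) * (N : ℝ)⁻¹ + θ * c / 2 := by
    intro θ hθ N hN
    have hN' : (0 : ℝ) < N := by exact_mod_cast hN
    have h1 := chain hx hy step hp hlam hT.le N
    have h2 := hw ((N + 1) * T) (by positivity)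
    have h3 := hxu (N * (lam * T)) (by positivity) θ hθ
    have h4 := hyu (N * ((1 - lam) * T)) (by positivity) θ hθ
    have l1 : Real.log (2 * π * (N * T)) ≤ Real.log (2 * π * ((N + 1) * T)) := by
      apply Real.log_le_log (by positivity)
      have : 0 < π * T := by positivity
      nlinarith
    have l2 : Real.log (2 * π * (N * (lam * T))) = Real.log (2 * π * (N * T)) + Real.log lam := by
      rw [← Real.log_mul (by positivity) (by positivity)]; congr 1; ring
    have l3 : Real.log (2 * π * (N * ((1 - lam) * T))) = Real.log (2 * π * (N * T)) + Real.log (1 - lam) := by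
      rw [← Real.log_mul (by positivity) (by positivity)]; congr 1; ring
    rw [l2] at h3
    rw [l3] at h4
    have l1' := mul_le_mul_of_nonneg_left l1 hν
    have h3' := mul_le_mul_of_nonneg_left h3 hl0.le
    have h4' := mul_le_mul_of_nonneg_left h4 hl1.le
    have e3 : lam * ((1 + 1 / θ) * mx / (N * (lam * T))) = (1 + 1 / θ) * mx / T * (N : ℝ)⁻¹ := by
      field_simp
    have e4 : (1 - lam) * ((1 + 1 / θ) * my / (N * ((1 - lam) * T))) = (1 + 1 / θ) * my / T * (N : ℝ)⁻¹ := by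
      field_simp
    have e5 : (1 + 1 / θ) * (mx + my) / T / 2 * (N : ℝ)⁻¹ =
      ((1 + 1 / θ) * mx / T * (N : ℝ)⁻¹ + (1 + 1 / θ) * my / T * (N : ℝ)⁻¹) / 2 := by ring
    rw [e5, ← e3, ← e4, negMulLog, negMulLog]
    nlinarith
  have m2 : ∀ θ > 0, lam * x 0 + (1 - lam) * y 0 + ν * (negMulLog lam + negMulLog (1 - lam)) ≤
      w T + θ * c / 2 := by
    intro θ hθ
    have lim : Tendsto (fun N : ℕ => w T + ((1 + 1 / θ) * (mx + my) / T / 2) * (N : ℝ)⁻¹ + θ * c / 2) atTop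
        (𝓝 (w T + ((1 + 1 / θ) * (mx + my) / T / 2) * 0 + θ * c / 2)) :=
      ((tendsto_inv_atTop_nhds_zero_nat.const_mul _).const_add _).add_const _
    have := ge_of_tendsto lim ((eventually_gt_atTop 0).mono fun N hN => main θ hθ N hN)
    linarith
  have lim : Tendsto (fun θ : ℝ => w T + θ * c / 2) (𝓝[>] 0) (𝓝 (w T + 0 * c / 2)) :=
    tendsto_nhdsWithin_of_tendsto_nhds
      ((by fun_prop : Continuous fun θ : ℝ => w T + θ * c / 2).tendsto 0)
  have := ge_of_tendsto lim (eventually_nhdsWithin_of_forall fun θ hθ => m2 θ hθ)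
  linarith

lemma final_real {x0 y0 w0 S ν : ℝ} (hν : 0 < ν)
    (h : ∀ p r : ℕ, 0 < p → 0 < r → ∀ lam : ℝ, lam = p / ((p + r : ℕ) : ℝ) →
      lam * x0 + (1 - lam) * y0 + ν * (negMulLog lam + negMulLog (1 - lam)) ≤ w0) :
    Real.exp ((x0 - S) / ν) + Real.exp ((y0 - S) / ν) ≤ Real.exp ((w0 - S) / ν) := by
  set f : ℝ → ℝ := fun lam => lam * x0 + (1 - lam) * y0 + ν * (negMulLog lam + negMulLog (1 - lam)) with hf
  have hfc : Continuous f := by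
    have := continuous_negMulLog
    simp only [hf]; fun_prop
  have hall : ∀ lam : ℝ, 0 < lam → lam < 1 → f lam ≤ w0 := by
    intro lam h0 h1
    by_contra hcon
    push Not at hcon
    have hopen : IsOpen ({l | w0 < f l} ∩ Set.Ioo 0 1) :=
      (isOpen_lt continuous_const hfc).inter isOpen_Ioo
    obtain ⟨q, hq⟩ := (Rat.denseRange_cast (𝕜 := ℝ)).exists_mem_open hopen ⟨lam, hcon, h0, h1⟩
    obtain ⟨hq1, hq2, hq3⟩ := hq
    have hq2' : (0 : ℚ) < q := by exact_mod_cast hq2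
    have hq3' : q < 1 := by exact_mod_cast hq3
    have hnum : 0 < q.num := Rat.num_pos.2 hq2'
    have hlt : q.num < q.den := Rat.num_lt_denom_iff.2 hq3'
    have := h q.num.toNat (q.den - q.num.toNat) (by omega) (by omega) q (by
      have e1 : q.num.toNat + (q.den - q.num.toNat) = q.den := by omega
      rw [e1]
      have e2 : ((q.num.toNat : ℕ) : ℝ) = (q.num : ℝ) := by
        have : ((q.num.toNat : ℕ) : ℤ) = q.num := Int.toNat_of_nonneg hnum.le
        exact_mod_cast congrArg (Int.cast : ℤ → ℝ) this
      rw [e2]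
      exact Rat.cast_def q)
    exact absurd this (not_le.2 hq1)
  set a := (x0 - S) / ν with ha
  set b := (y0 - S) / ν with hb
  set E := Real.exp a + Real.exp b with hE
  have hE0 : 0 < E := by positivity
  have key := hall (Real.exp a / E) (by positivity) (by
    rw [div_lt_one hE0]; have := Real.exp_pos b; linarith)
  have e1 : 1 - Real.exp a / E = Real.exp b / E := by field_simp; rw [hE]; ring
  have hx : x0 = ν * a + S := by rw [ha]; field_simp; ring
  have hy : y0 = ν * b + S := by rw [hb]; field_simp; ring
  simp only [hf, e1, negMulLog] at key
  rw [Real.log_div (Real.exp_pos a).ne' hE0.ne', Real.log_div (Real.exp_pos b).ne' hE0.ne',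
    Real.log_exp, Real.log_exp, hx, hy] at key
  have e2 : Real.exp a / E + Real.exp b / E = 1 := by linarith
  have key2 : Real.log E ≤ (w0 - S) / ν := by
    rw [le_div_iff₀ hν]
    have : Real.exp a / E * (ν * a + S) + Real.exp b / E * (ν * b + S) +
      ν * (-(Real.exp a / E) * (a - Real.log E) + -(Real.exp b / E) * (b - Real.log E)) =
      (Real.exp a / E + Real.exp b / E) * (S + ν * Real.log E) := by ring
    rw [this, e2] at key
    linarith
  calc E = Real.exp (Real.log E) := (Real.exp_log hE0).symm
    _ ≤ _ := Real.exp_le_exp.2 key2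

lemma Sys.epi {n d : ℕ} (hn : 0 < n) {R : En n × En n → Mat d} {X Y W : En n → Mat d} (S : Sys R X Y W)
    (mX : ∫ a, rtr (X a) = 1) (mY : ∫ a, rtr (Y a) = 1) (mW : ∫ a, rtr (W a) = 1)
    {M : Mat d} (eX : ∫ a, X a = M) (eY : ∫ a, Y a = M) (eW : ∫ a, W a = M) :
    Real.exp ((Hent volume X - vnEnt M) / ((n : ℝ) / 2)) + Real.exp ((Hent volume Y - vnEnt M) / ((n : ℝ) / 2))
      ≤ Real.exp ((Hent volume W - vnEnt M) / ((n : ℝ) / 2)) := by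
  have hn' : (0 : ℝ) < n := by exact_mod_cast hn
  refine final_real (by positivity) fun p r hp hr lam hlam => ?_
  rw [← gH_zero, ← gH_zero, ← gH_zero]
  refine gH_usc S.hW mW fun T hT => ?_
  refine chain_limit (x := gH X) (y := gH Y) (w := gH W) (S := vnEnt M) (c := c2 n) (mx := mom2 X)
    (my := mom2 Y) (fun r s t hr hs ht => gH_concav S.hX hr hs ht)
    (fun r s t hr hs ht => gH_concav S.hY hr hs ht)
    (fun s u h lam hs hu hh => S.step hs hu hh) (by positivity) ?_ ?_ ?_ hp hr hlam hT
  · intro t ht; rw [← eW]; exact gH_lower S.hW mW ht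
  · intro t ht θ hθ; rw [← eX]; exact gH_upper S.hX mX ht hθ
  · intro t ht θ hθ; rw [← eY]; exact gH_upper S.hY mY ht hθ

end partM

section partN

/-! ### translation from the statement -/

lemma cq_ent {d : ℕ} {α : Type*} [MeasureSpace α] {X τ : α → Mat d} {q : α → ℝ}
    (hX : FE volume X) (hq : ∀ a, rtr (X a) = q a)
    (hXe : ∀ᵐ a, X a = q a • τ a) (hτ : ∀ᵐ a, (τ a).IsHermitian) (hf : EntFinite q τ) :
    condEnt q τ = Hent volume X - vnEnt (∫ a, X a) := by
  have h1 : avgState q τ = ∫ a, X a := by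
    ext i j
    rw [entry_integral hX.integrable]
    simp only [avgState, Matrix.of_apply]
    refine integral_congr_ae ?_
    filter_upwards [hXe] with a ha
    rw [ha]
    simp [Matrix.smul_apply]
  have h2 : Hent volume X = (∫ a, q a * vnEnt (τ a)) + clEnt q := by
    unfold Hent clEnt
    rw [← sub_eq_add_neg, ← integral_sub hf.2 hf.1]
    refine integral_congr_ae ?_
    filter_upwards [hXe, hτ] with a ha hh
    have e : q a = q a * rtr (τ a) := by
      conv_lhs => rw [← hq a, ha, rtr_smul]
    rw [ha, vnEnt_smul hh]
    unfold negMulLog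
    linear_combination Real.log (q a) * e
  unfold condEnt
  rw [h1, h2]

/-- the matrix density of a classical-quantum state -/
def matD {d : ℕ} {α : Type*} (p : α → ℝ) (ρ : α → Mat d) : α → Mat d := fun z => p z • ρ z

lemma rtr_matD {n d : ℕ} {p : En n × En n → ℝ} {ρ : En n × En n → Mat d} (hcq : IsCQState p ρ)
    (z : En n × En n) : rtr (matD p ρ z) = p z := by
  have : rtr (ρ z) = 1 := by
    unfold rtr; rw [(hcq.2.2.2.2 z).2]; simp
  unfold matD
  rw [rtr_smul, this, mul_one]

lemma psd_matD {n d : ℕ} {p : En n × En n → ℝ} {ρ : En n × En n → Mat d} (hcq : IsCQState p ρ)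
    (z : En n × En n) : (matD p ρ z).PosSemidef :=
  (hcq.2.2.2.2 z).1.smul (hcq.2.1 z)

lemma sm_matD {n d : ℕ} {p : En n × En n → ℝ} {ρ : En n × En n → Mat d} (hcq : IsCQState p ρ) :
    StronglyMeasurable (matD p ρ) :=
  hcq.1.stronglyMeasurable.smul hcq.2.2.2.1.stronglyMeasurable

lemma FE2_matD {n d : ℕ} {p : En n × En n → ℝ} {ρ : En n × En n → Mat d} (hcq : IsCQState p ρ)
    (hX2 : Integrable fun z : En n × En n => ‖z.1‖ ^ 2 * p z)
    (hY2 : Integrable fun z : En n × En n => ‖z.2‖ ^ 2 * p z)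
    (hf : EntFinite p ρ) : FE2 (mm n) (matD p ρ) where
  sm := sm_matD hcq
  psd := psd_matD hcq
  int := by
    simp only [rtr_matD hcq]
    by_contra h
    have := integral_undef h
    have h2 := hcq.2.2.1
    rw [Measure.volume_eq_prod] at h2
    rw [h2] at this
    exact one_ne_zero this
  ent := by
    simp only [rtr_matD hcq]
    exact hf.1
  mom := by
    simp only [rtr_matD hcq]
    refine (hX2.add hY2).mono' ?_ (Eventually.of_forall fun z => ?_)
    · exact ((measurable_norm.pow_const 2).mul hcq.1).aestronglyMeasurable
    · have h0 := hcq.2.1 z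
      rw [Real.norm_of_nonneg (by positivity)]
      simp only [Pi.add_apply]
      rw [← add_mul]
      refine mul_le_mul_of_nonneg_right ?_ h0
      rw [Prod.norm_def]
      rcases max_choice ‖z.1‖ ‖z.2‖ with h | h <;> rw [h] <;> nlinarith [sq_nonneg ‖z.1‖, sq_nonneg ‖z.2‖]

section marg
variable {n d : ℕ} {p : En n × En n → ℝ} {ρ : En n × En n → Mat d}
  {φ : En n × En n → En n × En n} {L : En n × En n → En n} {q : En n → ℝ} {τ : En n → Mat d}

lemma marg_data (hcq : IsCQState p ρ) (hφ : MeasurePreserving φ (mm n) (mm n)) (hL : ∀ z, L (φ z) = z.1)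
    (hR : FE2 (mm n) (matD p ρ))
    (hLm : Integrable (fun z => ‖L z‖ ^ 2 * p z) (mm n))
    (hq : q = fun s => ∫ x, p (φ (s, x)))
    (hτ : τ = fun s => ((q s : ℂ))⁻¹ • Matrix.of fun i j => ∫ x, (p (φ (s, x)) : ℂ) * ρ (φ (s, x)) i j)
    (hf : EntFinite q τ) :
    FE2 volume (fun s => ∫ x, matD p ρ (φ (s, x))) ∧
      (∫ s, rtr (∫ x, matD p ρ (φ (s, x))) = 1) ∧
      (∫ s, ∫ x, matD p ρ (φ (s, x)) = ∫ z, matD p ρ z ∂(mm n)) ∧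
      condEnt q τ = Hent volume (fun s => ∫ x, matD p ρ (φ (s, x))) - vnEnt (∫ z, matD p ρ z ∂(mm n)) := by
  set X : En n → Mat d := fun s => ∫ x, matD p ρ (φ (s, x)) with hXdef
  have hRφ := hR.toFE.comp hφ
  have sX : StronglyMeasurable X := hRφ.sm.integral_prod_right
  have pX : ∀ s, (X s).PosSemidef := fun s => psd_integral fun x => psd_matD hcq _
  have tX : ∀ s, rtr (X s) = q s := by
    intro s
    rw [hXdef, hq]
    simp only
    rw [rtr_integral (R := fun x => matD p ρ (φ (s, x))) (hRφ.sm.comp_measurable (measurable_prodMk_left (x := s))) (fun x => psd_matD hcq _)]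
    simp only [rtr_matD hcq]
  have hpi : Integrable (fun z => p (φ z)) (mm n) := by
    have := hRφ.int
    simpa only [rtr_matD hcq] using this
  have hqi : Integrable q := by rw [hq]; exact hpi.integral_prod_left
  have hqe : ∫ s, q s = 1 := by
    have h2 := hcq.2.2.1
    rw [Measure.volume_eq_prod] at h2
    rw [hq, ← integral_prod (fun z => p (φ z)) hpi]
    have h3 : ∫ y, p y ∂(mm n) = 1 := h2
    rw [← hφ.map_eq, integral_map hφ.measurable.aemeasurable hcq.1.aestronglyMeasurable] at h3
    exact h3
  have hFE : FE volume X := by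
    refine ⟨sX, pX, ?_, ?_⟩
    · simp only [tX]; exact hqi
    · simp only [tX]; exact hf.1
  have hmom : Integrable (fun s => ‖s‖ ^ 2 * rtr (X s)) := by
    have h1 : Integrable (fun z => ‖z.1‖ ^ 2 * p (φ z)) (mm n) := by
      have := hφ.integrable_comp_of_integrable hLm
      refine this.congr (Eventually.of_forall fun z => ?_)
      simp [hL]
    have h2 := h1.integral_prod_left
    refine h2.congr (Eventually.of_forall fun s => ?_)
    simp only [tX, hq]
    rw [integral_const_mul]
  have hIX : ∫ s, X s = ∫ z, matD p ρ z ∂(mm n) := by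
    rw [hXdef, ← integral_prod (fun z => matD p ρ (φ z)) hRφ.integrable]
    conv_rhs => rw [← hφ.map_eq]
    rw [integral_map hφ.measurable.aemeasurable hR.sm.aestronglyMeasurable]
  have hsec := hRφ.integrable.prod_right_ae
  have hof : ∀ᵐ s, (Matrix.of fun i j => ∫ x, (p (φ (s, x)) : ℂ) * ρ (φ (s, x)) i j) = X s := by
    filter_upwards [hsec] with s hs
    ext i j
    rw [hXdef]
    simp only [Matrix.of_apply]
    rw [entry_integral hs]
    simp [matD, Matrix.smul_apply]
  have hτX : ∀ᵐ s, τ s = (q s)⁻¹ • X s := by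
    filter_upwards [hof] with s hs
    rw [hτ]
    beta_reduce
    rw [hs]
    ext i j
    simp [Matrix.smul_apply]
  refine ⟨⟨hFE, hmom⟩, ?_, hIX, ?_⟩
  · exact (integral_congr_ae (Eventually.of_forall tX)).trans hqe
  · rw [← hIX]
    refine cq_ent hFE tX ?_ ?_ hf
    · filter_upwards [hτX] with s hs
      by_cases h0 : q s = 0
      · rw [h0, zero_smul]
        exact eq_zero_of_rtr (pX s) (by rw [tX, h0])
      · rw [hs, smul_smul, mul_inv_cancel₀ h0, one_smul]
    · filter_upwards [hτX] with s hs
      rw [hs, Matrix.IsHermitian, Matrix.conjTranspose_smul, (pX s).1.eq]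
      simp

end marg

theorem epi_main {n d : ℕ} (hn : 0 < n)
    (p : En n × En n → ℝ) (ρ : En n × En n → Matrix (Fin d) (Fin d) ℂ)
    (hcq : IsCQState p ρ)
    (hX2 : Integrable fun z : En n × En n => ‖z.1‖ ^ 2 * p z)
    (hY2 : Integrable fun z : En n × En n => ‖z.2‖ ^ 2 * p z)
    (hXYfin : EntFinite p ρ)
    (hXfin : EntFinite (margFst p) (margFstState p ρ))
    (hYfin : EntFinite (margSnd p) (margSndState p ρ))
    (hSfin : EntFinite (sumDensity p) (sumState p ρ))
    (hindep : condMI p ρ = 0) :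
    Real.exp (2 * condEnt (sumDensity p) (sumState p ρ) / n)
      ≥ Real.exp (2 * condEnt (margFst p) (margFstState p ρ) / n)
        + Real.exp (2 * condEnt (margSnd p) (margSndState p ρ) / n) := by
  have hR := FE2_matD hcq hX2 hY2 hXYfin
  have hS2 : Integrable (fun z : En n × En n => ‖z.1 + z.2‖ ^ 2 * p z) (mm n) := by
    refine ((hX2.const_mul 2).add (hY2.const_mul 2)).mono' ?_ (Eventually.of_forall fun z => ?_)
    · exact (((measurable_fst.add measurable_snd).norm.pow_const 2).mul hcq.1).aestronglyMeasurable
    · have h0 := hcq.2.1 z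
      rw [Real.norm_of_nonneg (by positivity)]
      simp only [Pi.add_apply]
      have : ‖z.1 + z.2‖ ^ 2 ≤ 2 * ‖z.1‖ ^ 2 + 2 * ‖z.2‖ ^ 2 := by
        have := norm_add_le z.1 z.2
        have h3 := norm_nonneg (z.1 + z.2)
        nlinarith [sq_nonneg (‖z.1‖ - ‖z.2‖)]
      nlinarith [mul_le_mul_of_nonneg_right this h0]
  obtain ⟨x1, x2, x3, x4⟩ := marg_data (φ := id) (L := Prod.fst) (q := margFst p) (τ := margFstState p ρ)
    hcq (MeasurePreserving.id _) (fun z => rfl) hR hX2 rfl rfl hXfin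
  obtain ⟨y1, y2, y3, y4⟩ := marg_data (φ := Prod.swap) (L := Prod.snd) (q := margSnd p) (τ := margSndState p ρ)
    hcq Measure.measurePreserving_swap (fun z => rfl) hR hY2 rfl rfl hYfin
  obtain ⟨w1, w2, w3, w4⟩ := marg_data (φ := fun x => (x.2, x.1 - x.2)) (L := fun z => z.1 + z.2)
    (q := sumDensity p) (τ := sumState p ρ)
    hcq coordW.mp (fun z => by simp) hR hS2 rfl rfl hSfin
  have hRe : condEnt p ρ = Hent (mm n) (matD p ρ) - vnEnt (∫ z, matD p ρ z ∂(mm n)) :=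
    cq_ent (X := matD p ρ) hR.toFE (rtr_matD hcq) (Eventually.of_forall fun z => rfl)
      (Eventually.of_forall fun z => (hcq.2.2.2.2 z).1.1) hXYfin
  unfold condMI at hindep
  have S : Sys (matD p ρ) (fun s => ∫ x, matD p ρ (id (s, x))) (fun s => ∫ x, matD p ρ (Prod.swap (s, x)))
      (fun s => ∫ x, matD p ρ (((fun x => (x.2, x.1 - x.2)) : En n × En n → En n × En n) (s, x))) :=
    { hR := hR, hX := x1, hY := y1, hW := w1
      mX := Eventually.of_forall fun s => rfl
      mY := Eventually.of_forall fun s => rfl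
      mW := Eventually.of_forall fun s => rfl
      indep := by
        rw [x3]
        linarith }
  have := S.epi hn x2 y2 w2 x3 y3 w3
  rw [← x4, ← y4, ← w4] at this
  have e : ∀ c : ℝ, 2 * c / n = c / ((n : ℝ) / 2) := fun c => by
    have : (n : ℝ) ≠ 0 := by exact_mod_cast hn.ne'
    field_simp
  rw [e, e, e]
  exact this

end partN

end Aux

/-- The Entropy Power Inequality with quantum conditioning: for `X`, `Y` conditionally
independent given the quantum system `M`,
`exp(2 S(X+Y|M)/n) ≥ exp(2 S(X|M)/n) + exp(2 S(Y|M)/n)`. -/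
theorem entropy_power_inequality_quantum_conditioning {n d : ℕ} (hn : 0 < n)
    (p : En n × En n → ℝ) (ρ : En n × En n → Matrix (Fin d) (Fin d) ℂ)
    (hcq : IsCQState p ρ)
    (hX2 : Integrable fun z : En n × En n => ‖z.1‖ ^ 2 * p z)
    (hY2 : Integrable fun z : En n × En n => ‖z.2‖ ^ 2 * p z)
    (hXYfin : EntFinite p ρ)
    (hXfin : EntFinite (margFst p) (margFstState p ρ))
    (hYfin : EntFinite (margSnd p) (margSndState p ρ))
    (hSfin : EntFinite (sumDensity p) (sumState p ρ))
    (hindep : condMI p ρ = 0) :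
    Real.exp (2 * condEnt (sumDensity p) (sumState p ρ) / n)
      ≥ Real.exp (2 * condEnt (margFst p) (margFstState p ρ) / n)
        + Real.exp (2 * condEnt (margSnd p) (margSndState p ρ) / n) := by
  exact epi_main hn p ρ hcq hX2 hY2 hXYfin hXfin hYfin hSfin hindep

end
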